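/- arXiv:1703.00438 — 2 statements merged into one kernel-verified Lean document; each statement's English description precedes it below -/
import Mathlib

section
/- The ideal of k[x_1,…,x_a] generated by the images g(x_1,…,x_a,0,…,0) of all elements g ∈ I under setting x_{a+1} = … = x_n = 0 is a balanced complete intersection ideal of type (d)^a, i.e., it is generated by a regular sequence of a homogeneous forms of degree d in k[x_1,…,x_a]. -/
open MvPolynomial

namespace BalancedCI

attribute [local instance] MvPolynomial.gradedAlgebra

/-- `x` is a nonzerodivisor modulo `K`. -/
def NzdMod {A : Type*} [CommRing A] (K : Ideal A) (x : A) : Prop :=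
  ∀ z, x * z ∈ K → z ∈ K

/-- The ideal generated by `K` and the first `t` terms of the sequence `f`. -/
def prefixIdeal {A : Type*} [CommRing A] (K : Ideal A) (f : ℕ → A) (t : ℕ) : Ideal A :=
  K ⊔ Ideal.span (f '' Set.Iio t)

/-- The first `i` terms of `f` form a weakly regular sequence modulo `K`. -/
def RegMod {A : Type*} [CommRing A] (K : Ideal A) (f : ℕ → A) (i : ℕ) : Prop :=
  ∀ t < i, NzdMod (prefixIdeal K f t) (f t)

section CommRing

variable {A : Type*} [CommRing A]

lemma mem_sup_span_singleton {K : Ideal A} {x z : A} :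
    z ∈ K ⊔ Ideal.span {x} ↔ ∃ y, z - x * y ∈ K := by
  constructor
  · intro h
    obtain ⟨a, ha, b, hb, rfl⟩ := Submodule.mem_sup.1 h
    obtain ⟨c, rfl⟩ := Ideal.mem_span_singleton'.1 hb
    exact ⟨c, by rwa [mul_comm x c, add_sub_cancel_right]⟩
  · rintro ⟨y, hy⟩
    have h1 : z - x * y ∈ K ⊔ Ideal.span {x} := Ideal.mem_sup_left hy
    have h2 : x * y ∈ K ⊔ Ideal.span {x} :=
      Ideal.mem_sup_right (Ideal.mul_mem_right _ _ (Ideal.mem_span_singleton_self x))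
    simpa using add_mem h1 h2

@[simp]
lemma prefixIdeal_zero (K : Ideal A) (f : ℕ → A) : prefixIdeal K f 0 = K := by
  simp [prefixIdeal]

lemma prefixIdeal_succ (K : Ideal A) (f : ℕ → A) (t : ℕ) :
    prefixIdeal K f (t + 1) = prefixIdeal K f t ⊔ Ideal.span {f t} := by
  have h : Set.Iio (t + 1) = insert t (Set.Iio t) := by
    ext s
    simp only [Set.mem_Iio, Set.mem_insert_iff]
    omega
  rw [prefixIdeal, prefixIdeal, h, Set.image_insert_eq, Ideal.span_insert, sup_assoc,
    sup_comm (Ideal.span {f t})]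

lemma prefixIdeal_sup (K L : Ideal A) (f : ℕ → A) (t : ℕ) :
    prefixIdeal (K ⊔ L) f t = prefixIdeal K f t ⊔ L := by
  rw [prefixIdeal, prefixIdeal, sup_assoc, sup_comm L, sup_assoc]

lemma NzdMod.swap {L : Ideal A} {x h : A} (hx : NzdMod L x)
    (hh : NzdMod (L ⊔ Ideal.span {x}) h) : NzdMod (L ⊔ Ideal.span {h}) x := by
  intro z hz
  obtain ⟨y, hy⟩ := mem_sup_span_singleton.1 hz
  have h1 : h * y ∈ L ⊔ Ideal.span {x} := by
    refine mem_sup_span_singleton.2 ⟨z, ?_⟩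
    rw [← neg_sub]
    exact neg_mem hy
  obtain ⟨y', hy'⟩ := mem_sup_span_singleton.1 (hh y h1)
  refine mem_sup_span_singleton.2 ⟨y', hx _ ?_⟩
  have h2 := add_mem hy (L.mul_mem_left h hy')
  convert h2 using 1
  ring

lemma RegMod.sup_span_singleton {K : Ideal A} {f : ℕ → A} {i : ℕ} {h : A}
    (hf : RegMod K f i) (hh : ∀ t ≤ i, NzdMod (prefixIdeal K f t) h) :
    RegMod (K ⊔ Ideal.span {h}) f i := by
  intro t ht
  rw [prefixIdeal_sup]
  refine (hf t ht).swap ?_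
  rw [← prefixIdeal_succ]
  exact hh _ ht

end CommRing

section Swap

variable {k : Type*} [Field k] {σ : Type*}

/-- The socle of the quotient by `K` vanishes in degree `j`. -/
def SocleTrivial (j : ℕ) (K : Ideal (MvPolynomial σ k)) : Prop :=
  ∀ z : MvPolynomial σ k, z.IsHomogeneous j → (∀ i, X i * z ∈ K) → z ∈ K

/-- The socle of the quotient by `K` is at most one-dimensional in degree `j`. -/
def SocleLine (j : ℕ) (K : Ideal (MvPolynomial σ k)) : Prop :=
  ∀ z z' : MvPolynomial σ k, z.IsHomogeneous j → z'.IsHomogeneous j → (∀ i, X i * z ∈ K) →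
    (∀ i, X i * z' ∈ K) → z ∉ K → ∃ c : k, z' - C c * z ∈ K

/-- `K` contains all forms of degree `j`. -/
def Fills (j : ℕ) (K : Ideal (MvPolynomial σ k)) : Prop :=
  ∀ z : MvPolynomial σ k, z.IsHomogeneous j → z ∈ K

lemma homogeneousComponent_add_mul {x : MvPolynomial σ k} {d : ℕ} (hx : x.IsHomogeneous d)
    (j : ℕ) (u : MvPolynomial σ k) :
    homogeneousComponent (d + j) (x * u) = x * homogeneousComponent j u := by
  have := DirectSum.coe_decompose_mul_add_of_left_mem (homogeneousSubmodule σ k) (j := j) (b := u)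
    ((mem_homogeneousSubmodule d x).2 hx)
  exact (decomposition.decompose'_apply _ _).symm.trans
    (this.trans (congrArg (x * ·) (decomposition.decompose'_apply _ _)))

lemma homogeneousComponent_mul_of_lt {x : MvPolynomial σ k} {d : ℕ} (hx : x.IsHomogeneous d)
    {j : ℕ} (hj : j < d) (u : MvPolynomial σ k) :
    homogeneousComponent j (x * u) = 0 := by
  have := DirectSum.coe_decompose_mul_of_left_mem_of_not_le (homogeneousSubmodule σ k) (b := u)
    ((mem_homogeneousSubmodule d x).2 hx) (not_le.2 hj)
  exact (decomposition.decompose'_apply _ _).symm.trans this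

variable {K : Ideal (MvPolynomial σ k)} {x y : MvPolynomial σ k} {d : ℕ}

lemma mul_mem_of_forall_X_mul_mem (hd : d ≠ 0) (hx : x.IsHomogeneous d)
    {z : MvPolynomial σ k} (hz : ∀ i, X i * z ∈ K) : x * z ∈ K := by
  rw [x.as_sum, Finset.sum_mul]
  refine sum_mem fun m hm => ?_
  have hm0 : m ≠ 0 := by
    rintro rfl
    have := hx (mem_support_iff.1 hm)
    simp at this
    exact hd this.symm
  obtain ⟨i, hi⟩ := Finsupp.ne_iff.1 hm0
  have : monomial m (coeff m x) = monomial (m - Finsupp.single i 1) (coeff m x) * X i := by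
    rw [X, monomial_mul, mul_one, tsub_add_cancel_of_le]
    rw [Finsupp.single_le_iff]
    exact Nat.one_le_iff_ne_zero.2 hi
  rw [this, mul_assoc]
  exact K.mul_mem_left _ (hz i)

lemma NzdMod.mem_of_forall_X_mul_mem {z : MvPolynomial σ k}
    (hd : d ≠ 0) (hx : x.IsHomogeneous d) (hK : NzdMod K x) (hz : ∀ i, X i * z ∈ K) : z ∈ K :=
  hK z (mul_mem_of_forall_X_mul_mem hd hx hz)

lemma exists_socle_swap (hd : d ≠ 0) (hK : K.IsHomogeneous (homogeneousSubmodule σ k))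
    (hx : x.IsHomogeneous d) (hy : y.IsHomogeneous d) (hyK : NzdMod K y) {j : ℕ}
    {z : MvPolynomial σ k} (hz : z.IsHomogeneous j) (hzs : ∀ i, X i * z ∈ K ⊔ Ideal.span {y}) :
    ∃ z' : MvPolynomial σ k, z'.IsHomogeneous j ∧ (∀ i, X i * z' ∈ K ⊔ Ideal.span {x}) ∧
      x * z - y * z' ∈ K := by
  obtain ⟨w, hw⟩ := mem_sup_span_singleton.1 (mul_mem_of_forall_X_mul_mem hd hx hzs)
  have hcomp := homogeneousComponent_mem_of_mem hK hw (d + j)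
  rw [map_sub, homogeneousComponent_add_mul hx, homogeneousComponent_add_mul hy,
    homogeneousComponent_eq_self hz] at hcomp
  refine ⟨_, homogeneousComponent_isHomogeneous j w, fun i => ?_, hcomp⟩
  obtain ⟨u, hu⟩ := mem_sup_span_singleton.1 (hzs i)
  refine mem_sup_span_singleton.2 ⟨u, hyK _ ?_⟩
  have := sub_mem (K.mul_mem_left x hu) (K.mul_mem_left (X i) hcomp)
  convert this using 1
  ring

lemma mem_of_swap_mem (hxK : NzdMod K x) {z z' : MvPolynomial σ k} (h : x * z - y * z' ∈ K)
    (hz' : z' ∈ K ⊔ Ideal.span {x}) : z ∈ K ⊔ Ideal.span {y} := by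
  obtain ⟨u, hu⟩ := mem_sup_span_singleton.1 hz'
  refine mem_sup_span_singleton.2 ⟨u, hxK _ ?_⟩
  convert add_mem h (K.mul_mem_left y hu) using 1
  ring

lemma SocleTrivial.swap (hd : d ≠ 0) (hK : K.IsHomogeneous (homogeneousSubmodule σ k))
    (hx : x.IsHomogeneous d) (hy : y.IsHomogeneous d) (hxK : NzdMod K x) (hyK : NzdMod K y) {j : ℕ}
    (h : SocleTrivial j (K ⊔ Ideal.span {x})) : SocleTrivial j (K ⊔ Ideal.span {y}) := by
  intro z hz hzs
  obtain ⟨z', hz', hzs', hzz'⟩ := exists_socle_swap hd hK hx hy hyK hz hzs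
  exact mem_of_swap_mem hxK hzz' (h z' hz' hzs')

lemma SocleLine.swap (hd : d ≠ 0) (hK : K.IsHomogeneous (homogeneousSubmodule σ k))
    (hx : x.IsHomogeneous d) (hy : y.IsHomogeneous d) (hxK : NzdMod K x) (hyK : NzdMod K y) {j : ℕ}
    (h : SocleLine j (K ⊔ Ideal.span {x})) : SocleLine j (K ⊔ Ideal.span {y}) := by
  intro z₁ z₂ hz₁ hz₂ hzs₁ hzs₂ hzK
  obtain ⟨z₁', hz₁', hzs₁', hzz₁'⟩ := exists_socle_swap hd hK hx hy hyK hz₁ hzs₁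
  obtain ⟨z₂', hz₂', hzs₂', hzz₂'⟩ := exists_socle_swap hd hK hx hy hyK hz₂ hzs₂
  obtain ⟨c, hc⟩ := h z₁' z₂' hz₁' hz₂' hzs₁' hzs₂' fun hmem => hzK (mem_of_swap_mem hxK hzz₁' hmem)
  refine ⟨c, mem_of_swap_mem hxK ?_ hc⟩
  convert sub_mem hzz₂' (K.mul_mem_left (C c) hzz₁') using 1
  ring

/-- The image of the forms of degree `j` in the quotient by `K`. -/
noncomputable def quotientPart (K : Ideal (MvPolynomial σ k)) (j : ℕ) :
    Submodule k (MvPolynomial σ k ⧸ K) :=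
  (homogeneousSubmodule σ k j).map (Ideal.Quotient.mkₐ k K).toLinearMap

lemma map_mulLeft_quotientPart_le (hx : x.IsHomogeneous d) (j : ℕ) :
    (quotientPart K j).map (LinearMap.mulLeft k (Ideal.Quotient.mk K x)) ≤
      quotientPart K (d + j) := by
  rintro _ ⟨_, ⟨u, hu, rfl⟩, rfl⟩
  exact ⟨x * u, hx.mul hu, by simp⟩

lemma map_mulLeft_quotientPart_eq_iff (hK : K.IsHomogeneous (homogeneousSubmodule σ k))
    (hx : x.IsHomogeneous d) (j : ℕ) :
    (quotientPart K j).map (LinearMap.mulLeft k (Ideal.Quotient.mk K x)) =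
      quotientPart K (d + j) ↔ Fills (d + j) (K ⊔ Ideal.span {x}) := by
  rw [le_antisymm_iff, and_iff_right (map_mulLeft_quotientPart_le hx j)]
  constructor
  · intro h z hz
    obtain ⟨_, ⟨u, hu, rfl⟩, hzu⟩ := h ⟨z, hz, rfl⟩
    refine mem_sup_span_singleton.2 ⟨u, ?_⟩
    rw [← Ideal.Quotient.eq_zero_iff_mem, map_sub, sub_eq_zero, map_mul]
    exact hzu.symm
  · rintro h _ ⟨z, hz, rfl⟩
    obtain ⟨u, hu⟩ := mem_sup_span_singleton.1 (h z hz)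
    have hcomp := homogeneousComponent_mem_of_mem hK hu (d + j)
    rw [map_sub, homogeneousComponent_add_mul hx, homogeneousComponent_eq_self hz] at hcomp
    refine ⟨_, ⟨_, homogeneousComponent_isHomogeneous j u, rfl⟩, ?_⟩
    rw [← Ideal.Quotient.eq_zero_iff_mem, map_sub, sub_eq_zero, map_mul] at hcomp
    exact hcomp.symm

lemma Fills.swap [Finite σ] (hK : K.IsHomogeneous (homogeneousSubmodule σ k))
    (hx : x.IsHomogeneous d) (hy : y.IsHomogeneous d) (hxK : NzdMod K x) (hyK : NzdMod K y) {j : ℕ}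
    (h : Fills j (K ⊔ Ideal.span {x})) : Fills j (K ⊔ Ideal.span {y}) := by
  rcases lt_or_ge j d with hj | hj
  · intro z hz
    obtain ⟨u, hu⟩ := mem_sup_span_singleton.1 (h z hz)
    have hcomp := homogeneousComponent_mem_of_mem hK hu j
    rw [map_sub, homogeneousComponent_mul_of_lt hx hj, homogeneousComponent_eq_self hz,
      sub_zero] at hcomp
    exact Ideal.mem_sup_left hcomp
  · obtain ⟨e, rfl⟩ := Nat.exists_eq_add_of_le hj
    have hfin : ∀ j, Module.Finite k (quotientPart K j) := fun j =>
      Module.Finite.iff_fg.2 ((homogeneousSubmodule_fg σ k j).map _)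
    have hinj : ∀ {x : MvPolynomial σ k}, NzdMod K x →
        Function.Injective (LinearMap.mulLeft k (Ideal.Quotient.mk K x)) := by
      intro x hxK
      rw [injective_iff_map_eq_zero]
      intro z hz
      obtain ⟨z, rfl⟩ := Ideal.Quotient.mk_surjective z
      rw [LinearMap.mulLeft_apply, ← map_mul, Ideal.Quotient.eq_zero_iff_mem] at hz
      exact Ideal.Quotient.eq_zero_iff_mem.2 (hxK z hz)
    rw [← map_mulLeft_quotientPart_eq_iff hK hx] at h
    rw [← map_mulLeft_quotientPart_eq_iff hK hy]
    refine Submodule.eq_of_le_of_finrank_eq (map_mulLeft_quotientPart_le hy e) ?_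
    rw [← h, ← (Submodule.equivMapOfInjective _ (hinj hxK) (quotientPart K e)).finrank_eq,
      ← (Submodule.equivMapOfInjective _ (hinj hyK) (quotientPart K e)).finrank_eq]

end Swap

section Avoidance

variable {k : Type*} [Field k] {σ : Type*}

/-- Over an infinite field, a space of forms generating an ideal containing powers of all variables
contains a common nonzerodivisor modulo finitely many ideals with no socle. -/
lemma exists_nzdMod [Finite σ] [Infinite k] {ι : Type*} [Finite ι] (K : ι → Ideal (MvPolynomial σ k))
    (V : Submodule k (MvPolynomial σ k)) (N : ℕ)
    (hV : ∀ i, (X i : MvPolynomial σ k) ^ N ∈ Ideal.span (V : Set (MvPolynomial σ k)))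
    (hK : ∀ s z, (∀ i, X i * z ∈ K s) → z ∈ K s) :
    ∃ h ∈ V, ∀ s, NzdMod (K s) h := by
  by_contra! hcon
  let T := Σ s, associatedPrimes (MvPolynomial σ k) (MvPolynomial σ k ⧸ K s)
  have : ∀ s, Finite (associatedPrimes (MvPolynomial σ k) (MvPolynomial σ k ⧸ K s)) :=
    fun s => (associatedPrimes.finite _ _).to_subtype
  have : Finite T := inferInstanceAs (Finite (Sigma _))
  let p : T → Submodule k V := fun P => (P.2.1.restrictScalars k).comap V.subtype
  obtain ⟨⟨s, P, hP⟩, hPtop⟩ := Subspace.exists_eq_top_of_iUnion_eq_univ (p := p) (by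
    rw [Set.eq_univ_iff_forall]
    rintro ⟨h, hh⟩
    obtain ⟨s, hs⟩ := hcon h hh
    simp only [NzdMod, not_forall] at hs
    obtain ⟨z, hz, hzK⟩ := hs
    have hmem : h ∈ {r : MvPolynomial σ k | ∃ x : MvPolynomial σ k ⧸ K s, x ≠ 0 ∧ r • x = 0} := by
      refine ⟨Ideal.Quotient.mk _ z, ?_, ?_⟩
      · rwa [Ne, Ideal.Quotient.eq_zero_iff_mem]
      · rw [← Ideal.Quotient.mk_eq_mk, ← Submodule.Quotient.mk_smul, Ideal.Quotient.mk_eq_mk,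
          Ideal.Quotient.eq_zero_iff_mem]
        exact hz
    rw [← biUnion_associatedPrimes_eq_zero_divisors] at hmem
    simp only [Set.mem_iUnion] at hmem ⊢
    obtain ⟨P, hP, hhP⟩ := hmem
    exact ⟨⟨s, P, hP⟩, hhP⟩)
  have hVP : Ideal.span (V : Set (MvPolynomial σ k)) ≤ P := by
    rw [Ideal.span_le]
    intro v hv
    have : (⟨v, hv⟩ : V) ∈ p ⟨s, P, hP⟩ := hPtop ▸ Submodule.mem_top
    exact this
  have hPp : P.IsPrime := hP.isPrime
  have hXP : ∀ i, (X i : MvPolynomial σ k) ∈ P := fun i => hPp.mem_of_pow_mem N (hVP (hV i))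
  obtain ⟨-, x, hx⟩ := isAssociatedPrime_iff.1 hP
  obtain ⟨z, rfl⟩ := Ideal.Quotient.mk_surjective x
  have hmem : ∀ r, r ∈ P ↔ r * z ∈ K s := by
    intro r
    rw [hx, Submodule.mem_colon_singleton, Submodule.mem_bot, ← Ideal.Quotient.mk_eq_mk,
      ← Submodule.Quotient.mk_smul, Ideal.Quotient.mk_eq_mk, Ideal.Quotient.eq_zero_iff_mem,
      smul_eq_mul]
  have hz : z ∈ K s := hK s z fun i => (hmem _).1 (hXP i)
  exact hPp.ne_top ((Ideal.eq_top_iff_one _).2 ((hmem 1).2 (by rwa [one_mul])))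

lemma isHomogeneous_prefixIdeal {K : Ideal (MvPolynomial σ k)} {f : ℕ → MvPolynomial σ k} {d : ℕ}
    (hK : K.IsHomogeneous (homogeneousSubmodule σ k)) (hf : ∀ t, (f t).IsHomogeneous d) (t : ℕ) :
    (prefixIdeal K f t).IsHomogeneous (homogeneousSubmodule σ k) := by
  refine hK.sup (Ideal.homogeneous_span _ _ ?_)
  rintro _ ⟨s, -, rfl⟩
  exact ⟨d, hf s⟩

/-- A reflexive and transitive relation on ideals that holds between `K + (x)` and `K + (y)`, for
`x` and `y` forms of degree `d` that are nonzerodivisors modulo `K`, holds between any two ideals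
obtained from `K` by adjoining regular sequences of the same length of forms of degree `d`. -/
lemma rel_prefixIdeal [Finite σ] [Infinite k] {d : ℕ} (hd : d ≠ 0)
    (r : Ideal (MvPolynomial σ k) → Ideal (MvPolynomial σ k) → Prop)
    (hrefl : ∀ K, r K K) (htrans : ∀ K L M, r K L → r L M → r K M)
    (hswap : ∀ (K : Ideal (MvPolynomial σ k)) (x y : MvPolynomial σ k),
      K.IsHomogeneous (homogeneousSubmodule σ k) → x.IsHomogeneous d → y.IsHomogeneous d →
      NzdMod K x → NzdMod K y → r (K ⊔ Ideal.span {x}) (K ⊔ Ideal.span {y}))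
    (i : ℕ) (K : Ideal (MvPolynomial σ k)) (hK : K.IsHomogeneous (homogeneousSubmodule σ k))
    (f g : ℕ → MvPolynomial σ k) (hf : ∀ t, (f t).IsHomogeneous d)
    (hg : ∀ t, (g t).IsHomogeneous d) (hfr : RegMod K f i) (hgr : RegMod K g i) :
    r (prefixIdeal K f i) (prefixIdeal K g i) := by
  induction i generalizing K with
  | zero => simpa using hrefl K
  | succ i ih =>
    obtain ⟨h, hhd, hh⟩ := exists_nzdMod
      (Sum.elim (fun t : Fin (i + 1) => prefixIdeal K f t)
        (fun t : Fin (i + 1) => prefixIdeal K g t))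
      (homogeneousSubmodule σ k d) d
      (fun j => Ideal.subset_span (by simpa using isHomogeneous_X_pow j d))
      (by
        rintro (t | t) z hz
        · exact (hfr t t.2).mem_of_forall_X_mul_mem hd (hf t) hz
        · exact (hgr t t.2).mem_of_forall_X_mul_mem hd (hg t) hz)
    have hhf : ∀ t ≤ i, NzdMod (prefixIdeal K f t) h :=
      fun t ht => hh (Sum.inl ⟨t, Nat.lt_succ_of_le ht⟩)
    have hhg : ∀ t ≤ i, NzdMod (prefixIdeal K g t) h :=
      fun t ht => hh (Sum.inr ⟨t, Nat.lt_succ_of_le ht⟩)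
    have hmid := ih (K ⊔ Ideal.span {h})
      (hK.sup (Ideal.homogeneous_span _ _ (by rintro _ rfl; exact ⟨d, hhd⟩)))
      (RegMod.sup_span_singleton (fun t ht => hfr t (ht.trans (Nat.lt_succ_self i))) hhf)
      (RegMod.sup_span_singleton (fun t ht => hgr t (ht.trans (Nat.lt_succ_self i))) hhg)
    rw [prefixIdeal_sup, prefixIdeal_sup] at hmid
    rw [prefixIdeal_succ, prefixIdeal_succ]
    exact htrans _ _ _ (hswap _ _ _ (isHomogeneous_prefixIdeal hK hf i) (hf i) hhd
        (hfr i (Nat.lt_succ_self i)) (hhf i le_rfl))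
      (htrans _ _ _ hmid (hswap _ _ _ (isHomogeneous_prefixIdeal hK hg i) hhd (hg i)
        (hhg i le_rfl) (hgr i (Nat.lt_succ_self i))))

end Avoidance

section PurePowers

variable {k : Type*} [Field k] {b : ℕ}

/-- The sequence of `d`-th powers of the variables, extended by zero. -/
noncomputable def purePowers (k : Type*) [Field k] (b d : ℕ) (t : ℕ) : MvPolynomial (Fin b) k :=
  if h : t < b then X ⟨t, h⟩ ^ d else 0

lemma purePowers_of_lt {d t : ℕ} (h : t < b) : purePowers k b d t = X ⟨t, h⟩ ^ d := dif_pos h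

lemma isHomogeneous_purePowers (d t : ℕ) : (purePowers k b d t).IsHomogeneous d := by
  unfold purePowers
  split_ifs
  · exact isHomogeneous_X_pow _ _
  · exact isHomogeneous_zero _ _ _

lemma mem_prefixIdeal_purePowers {d i : ℕ} (hi : i ≤ b) {p : MvPolynomial (Fin b) k} :
    p ∈ prefixIdeal ⊥ (purePowers k b d) i ↔
      ∀ m ∈ p.support, ∃ t : Fin b, (t : ℕ) < i ∧ d ≤ m t := by
  have h : prefixIdeal ⊥ (purePowers k b d) i = Ideal.span ((fun s => monomial s (1 : k)) ''
      ((fun t : Fin b => Finsupp.single t d) '' {t | (t : ℕ) < i})) := by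
    rw [prefixIdeal, bot_sup_eq, Set.image_image]
    congr 1
    ext p
    constructor
    · rintro ⟨t, ht, rfl⟩
      exact ⟨⟨t, lt_of_lt_of_le ht hi⟩, ht,
        by rw [purePowers_of_lt (lt_of_lt_of_le ht hi), X_pow_eq_monomial]⟩
    · rintro ⟨t, ht, rfl⟩
      exact ⟨t, ht, by rw [purePowers_of_lt t.2, X_pow_eq_monomial]⟩
  rw [h, mem_ideal_span_monomial_image]
  simp [Finsupp.single_le_iff]

lemma regMod_purePowers {d i : ℕ} (hi : i ≤ b) : RegMod ⊥ (purePowers k b d) i := by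
  intro t ht z hz
  have htb := ht.trans_le hi
  rw [mem_prefixIdeal_purePowers htb.le] at hz ⊢
  intro m hm
  obtain ⟨s, hs, hds⟩ := hz (Finsupp.single ⟨t, htb⟩ d + m) (by
    rw [purePowers_of_lt htb, X_pow_eq_monomial, mem_support_iff, coeff_monomial_mul, one_mul]
    exact mem_support_iff.1 hm)
  refine ⟨s, hs, ?_⟩
  rwa [Finsupp.add_apply, Finsupp.single_eq_of_ne, zero_add] at hds
  rintro rfl
  exact lt_irrefl _ hs

lemma single_add_mem_support {t : Fin b} {z : MvPolynomial (Fin b) k} {m : Fin b →₀ ℕ}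
    (hm : m ∈ z.support) : Finsupp.single t 1 + m ∈ (X t * z).support := by
  rw [mem_support_iff, X, coeff_monomial_mul, one_mul]
  exact mem_support_iff.1 hm

lemma socleTrivial_purePowers_of_lt {d i : ℕ} (hi : i < b) (j : ℕ) :
    SocleTrivial j (prefixIdeal ⊥ (purePowers k b d) i) := by
  intro z _ hz
  rw [mem_prefixIdeal_purePowers hi.le]
  intro m hm
  obtain ⟨s, hs, hds⟩ := (mem_prefixIdeal_purePowers hi.le).1 (hz ⟨i, hi⟩) _
    (single_add_mem_support hm)
  refine ⟨s, hs, ?_⟩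
  rwa [Finsupp.add_apply, Finsupp.single_eq_of_ne, zero_add] at hds
  rintro rfl
  exact lt_irrefl _ hs

/-- A monomial of a socle element modulo the pure powers that is itself not divisible by a pure
power has all exponents equal to `d - 1`. -/
lemma eq_pred_of_socle_purePowers {d : ℕ} {z : MvPolynomial (Fin b) k}
    (hz : ∀ i, X i * z ∈ prefixIdeal ⊥ (purePowers k b d) b) {m : Fin b →₀ ℕ} (hm : m ∈ z.support)
    (hmd : ∀ t, m t < d) (t : Fin b) : m t = d - 1 := by
  obtain ⟨s, -, hds⟩ := (mem_prefixIdeal_purePowers le_rfl).1 (hz t) _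
    (single_add_mem_support hm)
  have hs := hmd s
  rw [Finsupp.add_apply] at hds
  by_cases hst : s = t
  · subst hst
    rw [Finsupp.single_eq_same] at hds
    omega
  · rw [Finsupp.single_eq_of_ne hst] at hds
    omega

lemma notMem_prefixIdeal_purePowers {d : ℕ} {z : MvPolynomial (Fin b) k} :
    z ∉ prefixIdeal ⊥ (purePowers k b d) b ↔ ∃ m ∈ z.support, ∀ t, m t < d := by
  rw [mem_prefixIdeal_purePowers le_rfl]
  simp

lemma socleTrivial_purePowers_of_ne {d j : ℕ} (hj : j ≠ b * (d - 1)) :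
    SocleTrivial j (prefixIdeal ⊥ (purePowers k b d) b) := by
  intro z hzj hz
  by_contra hzK
  obtain ⟨m, hm, hmd⟩ := notMem_prefixIdeal_purePowers.1 hzK
  apply hj
  rw [hzj.degree_eq_sum_deg_support hm, ← Finsupp.degree_apply, Finsupp.degree_eq_sum,
    Finset.sum_congr rfl fun t _ => eq_pred_of_socle_purePowers hz hm hmd t]
  simp

lemma socleLine_purePowers {d : ℕ} (j : ℕ) :
    SocleLine j (prefixIdeal ⊥ (purePowers k b d) b) := by
  intro z z' _ _ hz hz' hzK
  obtain ⟨m, hm, hmd⟩ := notMem_prefixIdeal_purePowers.1 hzK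
  have hmm := eq_pred_of_socle_purePowers hz hm hmd
  refine ⟨coeff m z' / coeff m z, ?_⟩
  by_contra hcon
  obtain ⟨m', hm', hmd'⟩ := notMem_prefixIdeal_purePowers.1 hcon
  have hmm' := eq_pred_of_socle_purePowers (fun i => by
    rw [mul_sub, mul_left_comm]
    exact sub_mem (hz' i) (Ideal.mul_mem_left _ _ (hz i))) hm' hmd'
  have : m' = m := Finsupp.ext fun t => (hmm' t).trans (hmm t).symm
  subst this
  rw [mem_support_iff, coeff_sub, coeff_C_mul, div_mul_cancel₀ _ (mem_support_iff.1 hm)] at hm'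
  exact hm' (sub_self _)

lemma fills_purePowers {d : ℕ} : Fills (b * (d - 1) + 1) (prefixIdeal ⊥ (purePowers k b d) b) := by
  intro z hz
  by_contra hcon
  obtain ⟨m, hm, hmd⟩ := notMem_prefixIdeal_purePowers.1 hcon
  have h1 := hz.degree_eq_sum_deg_support hm
  rw [← Finsupp.degree_apply, Finsupp.degree_eq_sum] at h1
  have h2 : ∑ t, m t ≤ ∑ _t : Fin b, (d - 1) :=
    Finset.sum_le_sum fun t _ => Nat.le_sub_one_of_lt (hmd t)
  simp at h2
  omega

lemma not_fills_purePowers {d : ℕ} (hd : d ≠ 0) :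
    ¬ Fills (b * (d - 1)) (prefixIdeal ⊥ (purePowers k b d) b) := by
  intro h
  refine notMem_prefixIdeal_purePowers.2 ⟨Finsupp.equivFunOnFinite.symm fun _ => d - 1, ?_, ?_⟩
    (h (monomial (Finsupp.equivFunOnFinite.symm fun _ => d - 1) 1)
      (isHomogeneous_monomial _ (by simp [Finsupp.degree_eq_sum])))
  · simp
  · intro t
    simp
    omega

end PurePowers

section RegularSequences

variable {k : Type*} [Field k] [Infinite k] {b d : ℕ} {f : ℕ → MvPolynomial (Fin b) k}

lemma RegMod.socleTrivial (hd : d ≠ 0) (hf : ∀ t, (f t).IsHomogeneous d) {i : ℕ} (hi : i ≤ b)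
    (hr : RegMod ⊥ f i) (j : ℕ)
    (h : SocleTrivial j (prefixIdeal ⊥ (purePowers k b d) i)) :
    SocleTrivial j (prefixIdeal ⊥ f i) :=
  rel_prefixIdeal hd (fun K L => SocleTrivial j K → SocleTrivial j L) (fun _ => id)
    (fun _ _ _ h₁ h₂ => h₂ ∘ h₁)
    (fun _ _ _ hK hx hy hxK hyK => SocleTrivial.swap hd hK hx hy hxK hyK) i ⊥
    (Ideal.IsHomogeneous.bot _) _ _ (isHomogeneous_purePowers d) hf (regMod_purePowers hi) hr h

lemma RegMod.socleLine (hd : d ≠ 0) (hf : ∀ t, (f t).IsHomogeneous d)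
    (hr : RegMod ⊥ f b) (j : ℕ) : SocleLine j (prefixIdeal ⊥ f b) :=
  rel_prefixIdeal hd (fun K L => SocleLine j K → SocleLine j L) (fun _ => id)
    (fun _ _ _ h₁ h₂ => h₂ ∘ h₁)
    (fun _ _ _ hK hx hy hxK hyK => SocleLine.swap hd hK hx hy hxK hyK) b ⊥
    (Ideal.IsHomogeneous.bot _) _ _ (isHomogeneous_purePowers d) hf (regMod_purePowers le_rfl) hr
    (socleLine_purePowers j)

lemma RegMod.fills_iff (hd : d ≠ 0) (hf : ∀ t, (f t).IsHomogeneous d)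
    (hr : RegMod ⊥ f b) (j : ℕ) :
    Fills j (prefixIdeal ⊥ (purePowers k b d) b) ↔ Fills j (prefixIdeal ⊥ f b) :=
  rel_prefixIdeal hd (fun K L => Fills j K ↔ Fills j L) (fun _ => Iff.rfl)
    (fun _ _ _ => Iff.trans)
    (fun _ _ _ hK hx hy hxK hyK => ⟨Fills.swap hK hx hy hxK hyK, Fills.swap hK hy hx hyK hxK⟩) b ⊥
    (Ideal.IsHomogeneous.bot _) _ _ (isHomogeneous_purePowers d) hf (regMod_purePowers le_rfl) hr

lemma RegMod.fills (hd : d ≠ 0) (hf : ∀ t, (f t).IsHomogeneous d)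
    (hr : RegMod ⊥ f b) : Fills (b * (d - 1) + 1) (prefixIdeal ⊥ f b) :=
  (hr.fills_iff hd hf _).1 fills_purePowers

lemma RegMod.not_fills (hd : d ≠ 0) (hf : ∀ t, (f t).IsHomogeneous d)
    (hr : RegMod ⊥ f b) : ¬ Fills (b * (d - 1)) (prefixIdeal ⊥ f b) :=
  fun h => not_fills_purePowers hd ((hr.fills_iff hd hf _).2 h)

/-- A regular sequence of fewer than `b` forms in `b` variables has a quotient without socle. -/
lemma RegMod.mem_of_forall_X_mul_mem (hd : d ≠ 0) (hf : ∀ t, (f t).IsHomogeneous d) {i : ℕ}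
    (hi : i < b) (hr : RegMod ⊥ f i) {z : MvPolynomial (Fin b) k}
    (hz : ∀ t, X t * z ∈ prefixIdeal ⊥ f i) : z ∈ prefixIdeal ⊥ f i := by
  have hK := isHomogeneous_prefixIdeal (Ideal.IsHomogeneous.bot (homogeneousSubmodule (Fin b) k))
    hf i
  rw [mem_iff_homogeneousComponent_mem hK]
  intro j
  refine hr.socleTrivial hd hf hi.le j (socleTrivial_purePowers_of_lt hi j) _
    (homogeneousComponent_isHomogeneous j z) fun t => ?_
  rw [← homogeneousComponent_add_mul (isHomogeneous_X k t)]
  exact homogeneousComponent_mem_of_mem hK (hz t) _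

lemma prefixIdeal_congr {A : Type*} [CommRing A] (K : Ideal A) {f g : ℕ → A} {t : ℕ}
    (h : ∀ s < t, f s = g s) : prefixIdeal K f t = prefixIdeal K g t := by
  rw [prefixIdeal, prefixIdeal, Set.image_congr (s := Set.Iio t) fun s hs => h s hs]

/-- A space of forms of degree `d` generating an ideal containing powers of all variables contains
a regular sequence of maximal length. -/
lemma exists_regMod (hd : d ≠ 0) (V : Submodule k (MvPolynomial (Fin b) k))
    (hVd : ∀ v ∈ V, v.IsHomogeneous d) (N : ℕ)
    (hV : ∀ i, (X i : MvPolynomial (Fin b) k) ^ N ∈ Ideal.span (V : Set (MvPolynomial (Fin b) k))) :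
    ∃ q : ℕ → MvPolynomial (Fin b) k, (∀ t, q t ∈ V) ∧ RegMod ⊥ q b := by
  suffices H : ∀ i ≤ b, ∃ q : ℕ → MvPolynomial (Fin b) k, (∀ t, q t ∈ V) ∧ RegMod ⊥ q i from
    H b le_rfl
  intro i
  induction i with
  | zero => exact fun _ => ⟨0, fun _ => V.zero_mem, fun t ht => absurd ht (Nat.not_lt_zero t)⟩
  | succ i ih =>
    intro hi
    obtain ⟨q, hqV, hq⟩ := ih (Nat.le_of_succ_le hi)
    obtain ⟨h, hhV, hh⟩ := exists_nzdMod (fun _ : Unit => prefixIdeal ⊥ q i) V N hV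
      fun _ z hz => hq.mem_of_forall_X_mul_mem hd (fun t => hVd _ (hqV t)) hi hz
    have hcongr : ∀ t ≤ i, prefixIdeal ⊥ (Function.update q i h) t = prefixIdeal ⊥ q t :=
      fun t ht => prefixIdeal_congr _ fun s hs =>
        Function.update_of_ne (ne_of_lt (hs.trans_le ht)) _ _
    refine ⟨Function.update q i h, fun t => ?_, fun t ht => ?_⟩
    · rcases eq_or_ne t i with rfl | hti
      · rwa [Function.update_self]
      · rw [Function.update_of_ne hti]
        exact hqV t
    · rw [hcongr t (Nat.le_of_lt_succ ht)]
      rcases eq_or_ne t i with rfl | hti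
      · rw [Function.update_self]
        exact hh ()
      · rw [Function.update_of_ne hti]
        exact hq t (by omega)

/-- An ideal strictly larger than a complete intersection contains its socle degree. -/
lemma RegMod.fills_of_notMem (hd : d ≠ 0) (hf : ∀ t, (f t).IsHomogeneous d) (hr : RegMod ⊥ f b)
    {J : Ideal (MvPolynomial (Fin b) k)} (hJ : prefixIdeal ⊥ f b ≤ J) {j : ℕ}
    (hj : j ≤ b * (d - 1) + 1) {v : MvPolynomial (Fin b) k} (hv : v.IsHomogeneous j)
    (hvJ : v ∈ J) (hvf : v ∉ prefixIdeal ⊥ f b) : Fills (b * (d - 1)) J := by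
  induction hj using Nat.decreasingInduction generalizing v with
  | self => exact absurd (hr.fills hd hf v hv) hvf
  | of_succ j hj ih =>
    by_cases hs : ∀ t, X t * v ∈ prefixIdeal ⊥ f b
    · have hjb : j = b * (d - 1) := by
        by_contra hne
        exact hvf (hr.socleTrivial hd hf le_rfl j (socleTrivial_purePowers_of_ne hne) v hv hs)
      subst hjb
      intro u hu
      obtain ⟨c, hc⟩ := hr.socleLine hd hf _ v u hv hu hs (fun t => hr.fills hd hf _ (by
        rw [add_comm]
        exact (isHomogeneous_X k t).mul hu)) hvf
      simpa using add_mem (hJ hc) (J.mul_mem_left (C c) hvJ)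
    · push Not at hs
      obtain ⟨t, ht⟩ := hs
      refine ih ?_ (J.mul_mem_left (X t) hvJ) ht
      rw [add_comm]
      exact (isHomogeneous_X k t).mul hv

end RegularSequences

section Sequence

variable {A : Type*} [CommRing A]

lemma ofList_take_ofFn {b : ℕ} (f : ℕ → A) {t : ℕ} (ht : t ≤ b) :
    Ideal.ofList ((List.ofFn fun i : Fin b => f i).take t) = prefixIdeal ⊥ f t := by
  rw [prefixIdeal, bot_sup_eq, Ideal.ofList]
  congr 1
  ext x
  simp only [Set.mem_image, Set.mem_Iio, List.mem_take_iff_getElem]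
  constructor
  · rintro ⟨i, hi, rfl⟩
    exact ⟨i, by omega, by simp⟩
  · rintro ⟨i, hi, rfl⟩
    exact ⟨i, by simp; omega, by simp⟩

lemma isWeaklyRegular_ofFn_iff {b : ℕ} (f : ℕ → A) :
    RingTheory.Sequence.IsWeaklyRegular A (List.ofFn fun i : Fin b => f i) ↔ RegMod ⊥ f b := by
  rw [RingTheory.Sequence.isWeaklyRegular_iff]
  have key : ∀ t, (ht : t < b) →
      (IsSMulRegular (A ⧸ (Ideal.ofList ((List.ofFn fun i : Fin b => f i).take t) • ⊤ :
        Submodule A A)) (f t) ↔ NzdMod (prefixIdeal ⊥ f t) (f t)) := by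
    intro t ht
    rw [isSMulRegular_quotient_iff_mem_of_smul_mem, smul_eq_mul, Ideal.mul_top,
      ofList_take_ofFn f ht.le]
    rfl
  constructor
  · intro h t ht
    have := h t (by simpa using ht)
    rw [← key t ht]
    simpa using this
  · intro h t ht
    have htb : t < b := by simpa using ht
    have := (key t htb).2 (h t htb)
    simpa using this

end Sequence

section Straightening

variable {k : Type*} [Field k] {n : ℕ}

/-- The degree of a monomial in the first `b` variables. -/
def initialDegree (b : ℕ) (c : Fin n →₀ ℕ) : ℕ := ∑ i : Fin n, if (i : ℕ) < b then c i else 0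

lemma initialDegree_add (b : ℕ) (c c' : Fin n →₀ ℕ) :
    initialDegree b (c + c') = initialDegree b c + initialDegree b c' := by
  simp only [initialDegree, ← Finset.sum_add_distrib, Finsupp.add_apply]
  refine Finset.sum_congr rfl fun i _ => ?_
  split_ifs <;> rfl

lemma initialDegree_le_degree (b : ℕ) (c : Fin n →₀ ℕ) : initialDegree b c ≤ c.degree := by
  rw [initialDegree, Finsupp.degree_eq_sum]
  refine Finset.sum_le_sum fun i _ => ?_
  split_ifs <;> simp

lemma initialDegree_eq_degree {b b' : ℕ} (hb : b ≤ b') {c : Fin n →₀ ℕ}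
    (hc : ∀ i : Fin n, b ≤ i → c i = 0) : initialDegree b' c = c.degree := by
  rw [initialDegree, Finsupp.degree_eq_sum]
  refine Finset.sum_congr rfl fun i _ => ?_
  split_ifs with h
  · rfl
  · exact (hc i (hb.trans (not_lt.1 h))).symm

lemma eq_zero_of_degree_le_initialDegree {b : ℕ} {c : Fin n →₀ ℕ}
    (hc : c.degree ≤ initialDegree b c) (i : Fin n) (hi : b ≤ i) : c i = 0 := by
  have hle : ∀ j ∈ Finset.univ, (if ((j : Fin n) : ℕ) < b then c j else 0) ≤ c j := fun j _ => by
    split_ifs <;> simp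
  have := (Finset.sum_eq_sum_iff_of_le hle).1
    (le_antisymm (initialDegree_le_degree b c |>.trans_eq (Finsupp.degree_eq_sum c))
      ((Finsupp.degree_eq_sum c).symm.trans_le hc)) i (Finset.mem_univ i)
  rw [if_neg (not_lt.2 hi)] at this
  exact this.symm

lemma exists_le_of_le_initialDegree {b D : ℕ} {c : Fin n →₀ ℕ} (hD : D ≤ initialDegree b c) :
    ∃ c' ≤ c, (∀ i : Fin n, b ≤ i → c' i = 0) ∧ c'.degree = D := by
  have hdeg : (c.filter fun i : Fin n => (i : ℕ) < b).degree = initialDegree b c := by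
    rw [Finsupp.degree_eq_sum, initialDegree]
    simp [Finsupp.filter_apply]
  obtain ⟨c', hc', hdeg'⟩ := Finsupp.exists_le_degree_eq _ D (hD.trans_eq hdeg.symm)
  refine ⟨c', fun i => (hc' i).trans ?_, fun i hi => ?_, hdeg'⟩
  · rw [Finsupp.filter_apply]
    split_ifs <;> simp
  · have := hc' i
    rw [Finsupp.filter_apply, if_neg (not_lt.2 hi)] at this
    exact Nat.le_zero.1 this

/-- Modulo `I`, monomials of degree `D` in the first `b` variables are combinations of monomials of
degree `D` that involve the remaining variables. -/
def Straightens (I : Ideal (MvPolynomial (Fin n) k)) (b D : ℕ) : Prop :=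
  ∀ c : Fin n →₀ ℕ, (∀ i : Fin n, b ≤ i → c i = 0) → c.degree = D →
    ∃ p ∈ I, ∀ m ∈ (monomial c (1 : k) - p).support, m.degree = D ∧ initialDegree b m < D

lemma straightens_of_fills {I : Ideal (MvPolynomial (Fin n) k)}
    (hI : I.IsHomogeneous (homogeneousSubmodule (Fin n) k)) {b D : ℕ} (hb : b ≤ n)
    (hD : Fills D (I.map (killCompl (R := k) (Fin.castLE_injective hb)))) :
    Straightens I b D := by
  intro c hc hcD
  have hsurj : Function.Surjective (killCompl (R := k) (Fin.castLE_injective hb)) :=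
    fun p => ⟨_, killCompl_rename_app _ p⟩
  have hrange : ∀ {m : Fin n →₀ ℕ}, (∀ i : Fin n, b ≤ i → m i = 0) →
      ∃ m' : Fin b →₀ ℕ, m'.mapDomain (Fin.castLE hb) = m := fun {m} hm => by
    refine ⟨_, Finsupp.mapDomain_comapDomain _ (Fin.castLE_injective hb) m fun i hi => ?_⟩
    by_contra hcon
    refine Finsupp.mem_support_iff.1 hi (hm i ?_)
    by_contra hib
    exact hcon ⟨⟨i, not_le.1 hib⟩, rfl⟩
  obtain ⟨c', rfl⟩ := hrange hc
  have hmem := hD (monomial c' 1) (isHomogeneous_monomial _ (by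
    rw [← hcD, Finsupp.degree_mapDomain]))
  obtain ⟨p, hp, hpc⟩ := (Ideal.mem_map_iff_of_surjective _ hsurj).1 hmem
  refine ⟨homogeneousComponent D p, homogeneousComponent_mem_of_mem hI hp D, fun m hm => ?_⟩
  have hmD : m.degree = D := by
    have := (IsHomogeneous.sub (isHomogeneous_monomial (1 : k) hcD)
      (homogeneousComponent_isHomogeneous D p)).degree_eq_sum_deg_support hm
    rw [this, Finsupp.degree_apply]
  refine ⟨hmD, ?_⟩
  by_contra hcon
  obtain ⟨m', rfl⟩ := hrange
    (eq_zero_of_degree_le_initialDegree (hmD.trans_le (not_lt.1 hcon)))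
  refine mem_support_iff.1 hm ?_
  rw [coeff_sub, coeff_homogeneousComponent, if_pos hmD,
    ← coeff_killCompl (Fin.castLE_injective hb), ← coeff_killCompl (Fin.castLE_injective hb), hpc,
    killCompl_monomial_mapDomain, sub_self]

lemma straightens_span_of_fills {d : ℕ} {g : Fin n → MvPolynomial (Fin n) k}
    (hg : ∀ i, (g i).IsHomogeneous d) {b D : ℕ} (hb : b ≤ n)
    (hD : Fills D ((Ideal.span (Set.range g)).map (killCompl (R := k) (Fin.castLE_injective hb)))) :
    Straightens (Ideal.span (Set.range g)) b D := by
  refine straightens_of_fills (Ideal.homogeneous_span _ _ ?_) hb hD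
  rintro _ ⟨i, rfl⟩
  exact ⟨d, hg i⟩

lemma exists_notMem_of_straightens {I : Ideal (MvPolynomial (Fin n) k)} {b D : ℕ}
    (hI : Straightens I b D) {m : Fin n →₀ ℕ} (hm : monomial m (1 : k) ∉ I)
    (hmD : D ≤ initialDegree b m) :
    ∃ m' : Fin n →₀ ℕ, monomial m' (1 : k) ∉ I ∧ m'.degree = m.degree ∧
      initialDegree b m' < initialDegree b m ∧
      ∀ b', b ≤ b' → initialDegree b' m' ≤ initialDegree b' m := by
  obtain ⟨c, hcm, hcb, hcD⟩ := exists_le_of_le_initialDegree hmD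
  obtain ⟨r, rfl⟩ := exists_add_of_le hcm
  obtain ⟨p, hp, hpc⟩ := hI c hcb hcD
  by_contra! hcon
  apply hm
  have hrest : (monomial c (1 : k) - p) * monomial r 1 ∈ I := by
    rw [(monomial c (1 : k) - p).as_sum, Finset.sum_mul]
    refine sum_mem fun m hmem => ?_
    obtain ⟨hdeg, hlt⟩ := hpc m hmem
    rw [monomial_mul, mul_one, ← mul_one (coeff m _), ← C_mul_monomial]
    refine I.mul_mem_left _ ?_
    by_contra hmr
    obtain ⟨b', hbb', hb'⟩ := hcon (m + r) hmr (by rw [map_add, map_add, hdeg, hcD]) (by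
      rw [initialDegree_add, initialDegree_add, initialDegree_eq_degree le_rfl hcb, hcD]
      omega)
    rw [initialDegree_add, initialDegree_add, initialDegree_eq_degree hbb' hcb, hcD] at hb'
    have := initialDegree_le_degree b' m
    omega
  rw [sub_mul, monomial_mul, mul_one] at hrest
  simpa using add_mem hrest (I.mul_mem_right (monomial r 1) hp)

/-- If `I` misses a monomial of some degree, then it misses a monomial of that degree with initial
degrees bounded by any function `β` such that `I` straightens degrees above `β`. -/
lemma exists_monomial_notMem {I : Ideal (MvPolynomial (Fin n) k)} (β : ℕ → ℕ)
    (hI : ∀ b < n, Straightens I b (β b + 1)) {m : Fin n →₀ ℕ} (hm : monomial m (1 : k) ∉ I) :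
    ∃ m' : Fin n →₀ ℕ, monomial m' (1 : k) ∉ I ∧ m'.degree = m.degree ∧
      ∀ b < n, initialDegree b m' ≤ β b := by
  suffices H : ∀ b ≤ n, ∃ m' : Fin n →₀ ℕ, monomial m' (1 : k) ∉ I ∧ m'.degree = m.degree ∧
      ∀ b' < n, b ≤ b' → initialDegree b' m' ≤ β b' by
    simpa using H 0 (Nat.zero_le n)
  intro b hb
  induction hb using Nat.decreasingInduction with
  | self => exact ⟨m, hm, rfl, fun b' h₁ h₂ => absurd h₁ (not_lt.2 h₂)⟩
  | of_succ b hb ih =>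
    obtain ⟨c, hc, hcdeg, hcβ⟩ := ih
    induction hs : initialDegree b c using Nat.strong_induction_on generalizing c with
    | _ s ihs =>
      subst hs
      by_cases hcb : initialDegree b c ≤ β b
      · refine ⟨c, hc, hcdeg, fun b' hb' hbb' => ?_⟩
        rcases hbb'.eq_or_lt with rfl | hlt
        · exact hcb
        · exact hcβ b' hb' hlt
      · obtain ⟨c', hc', hdeg, hlt, hle⟩ := exists_notMem_of_straightens (hI b hb) hc
          (Nat.succ_le_of_lt (not_le.1 hcb))
        exact ihs _ hlt c' hc' (hdeg.trans hcdeg)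
          (fun b' hb' hbb' => (hle b' (Nat.le_of_succ_le hbb')).trans (hcβ b' hb' hbb')) rfl

lemma initialDegree_eq_sum_range {b : ℕ} (hb : b ≤ n) (c : Fin n →₀ ℕ) :
    initialDegree b c = ∑ i ∈ Finset.range b, if h : i < n then c ⟨i, h⟩ else 0 := by
  have h1 : initialDegree b c =
      ∑ i : Fin n, (fun i : ℕ => if i < b then (if h : i < n then c ⟨i, h⟩ else 0) else 0) i := by
    simp [initialDegree]
  rw [h1]
  refine (Fin.sum_univ_eq_sum_range
    (fun i : ℕ => if i < b then (if h : i < n then c ⟨i, h⟩ else 0) else 0) n).trans ?_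
  rw [← Finset.sum_filter]
  congr 1
  ext i
  simp only [Finset.mem_filter, Finset.mem_range]
  omega

/-- Monomials with small initial degrees have positive weight. -/
lemma weight_pos {e : ℕ} (w : Fin n → ℤ) (hwsum : ∑ i, w i = 0) (hw : Monotone w) {a : ℕ}
    (ha : 1 ≤ a) (han : a < n) (hlt : w ⟨a - 1, by omega⟩ < w ⟨a, han⟩) (c : Fin n →₀ ℕ)
    (hcn : c.degree = n * e) (hc : ∀ b < n, initialDegree b c ≤ b * e)
    (hca : initialDegree a c < a * e) : 0 < ∑ i, w i * (c i : ℤ) := by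
  let W : ℕ → ℤ := fun i => if h : i < n then w ⟨i, h⟩ else 0
  let E : ℕ → ℤ := fun i => ((if h : i < n then c ⟨i, h⟩ else 0 : ℕ) : ℤ) - e
  have hWE : ∑ i, w i * (c i : ℤ) = ∑ i ∈ Finset.range n, W i • E i := by
    have h1 : ∑ i, w i * (c i : ℤ) = ∑ i, w i * ((c i : ℤ) - e) := by
      simp_rw [mul_sub, Finset.sum_sub_distrib, ← Finset.sum_mul, hwsum]
      simp
    rw [h1, ← Fin.sum_univ_eq_sum_range (fun i => W i • E i)]
    simp [W, E]
  have hE : ∀ b ≤ n, ∑ i ∈ Finset.range b, E i = (initialDegree b c : ℤ) - b * e := by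
    intro b hb
    rw [initialDegree_eq_sum_range hb]
    simp only [E, Finset.sum_sub_distrib, Finset.sum_const, Finset.card_range, nsmul_eq_mul]
    push_cast
    rfl
  have hW : ∀ i, (hi : i + 1 < n) → 0 ≤ W (i + 1) - W i := by
    intro i hi
    simp only [W, dif_pos hi, dif_pos (Nat.lt_of_succ_lt hi), sub_nonneg]
    exact hw (by simp)
  have hn : initialDegree n c = n * e := by
    rw [initialDegree_eq_degree le_rfl fun i hi => absurd i.2 (not_lt.2 hi), hcn]
  rw [hWE, Finset.sum_range_by_parts, hE n le_rfl, hn]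
  push_cast
  rw [sub_self, smul_zero, zero_sub, ← Finset.sum_neg_distrib]
  refine Finset.sum_pos' (fun i hi => ?_) ⟨a - 1, Finset.mem_range.2 (by omega), ?_⟩
  · have hi' := Finset.mem_range.1 hi
    rw [hE _ (by omega), smul_eq_mul, neg_mul_eq_mul_neg]
    refine mul_nonneg (hW i (by omega)) ?_
    have := hc (i + 1) (by omega)
    rw [neg_nonneg, sub_nonpos]
    exact_mod_cast this
  · rw [Nat.sub_add_cancel ha, hE a han.le, smul_eq_mul, neg_mul_eq_mul_neg]
    refine mul_pos ?_ ?_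
    · simpa only [W, dif_pos han, dif_pos (show a - 1 < n by omega), sub_pos] using hlt
    · rw [neg_pos, sub_neg]
      exact_mod_cast hca

end Straightening

section Restriction

variable {k : Type*} [Field k] {n d : ℕ}

lemma aeval_eq_killCompl {b : ℕ} (hb : b ≤ n) :
    (aeval fun i : Fin n =>
      if h : (i : ℕ) < b then (X (⟨i, h⟩ : Fin b) : MvPolynomial (Fin b) k) else 0 :
        MvPolynomial (Fin n) k →ₐ[k] MvPolynomial (Fin b) k) =
      killCompl (Fin.castLE_injective hb) := by
  refine algHom_ext fun i => ?_
  rw [aeval_X]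
  split_ifs with h
  · have hi : (X i : MvPolynomial (Fin n) k) = rename (Fin.castLE hb) (X ⟨i, h⟩) := by
      rw [rename_X]
      rfl
    rw [hi, killCompl_rename_app]
  · rw [killCompl, aeval_X, dif_neg]
    rintro ⟨j, rfl⟩
    exact h j.2

lemma isHomogeneous_killCompl {b : ℕ} (hb : b ≤ n) {p : MvPolynomial (Fin n) k}
    (hp : p.IsHomogeneous d) :
    (killCompl (Fin.castLE_injective hb) p).IsHomogeneous d := by
  rw [← aeval_eq_killCompl]
  refine Eq.subst (motive := IsHomogeneous _) (one_mul d) (hp.aeval _ fun i => ?_)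
  split_ifs
  · exact isHomogeneous_X _ _
  · exact isHomogeneous_zero _ _ _

/-- The restriction of an ideal generated by forms of degree `d` and containing all forms of some
degree contains a regular sequence of maximal length of forms of degree `d`. -/
lemma exists_regMod_killCompl [Infinite k] (hd : d ≠ 0) (g : Fin n → MvPolynomial (Fin n) k)
    (hg : ∀ i, (g i).IsHomogeneous d) {N : ℕ} (hN : Fills N (Ideal.span (Set.range g)))
    {b : ℕ} (hb : b ≤ n) :
    ∃ q : ℕ → MvPolynomial (Fin b) k, (∀ t, (q t).IsHomogeneous d) ∧ RegMod ⊥ q b ∧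
      prefixIdeal ⊥ q b ≤
        (Ideal.span (Set.range g)).map (killCompl (R := k) (Fin.castLE_injective hb)) := by
  let V : Submodule k (MvPolynomial (Fin b) k) :=
    Submodule.span k (killCompl (Fin.castLE_injective hb) '' Set.range g)
  have hVd : V ≤ homogeneousSubmodule (Fin b) k d := by
    rw [Submodule.span_le]
    rintro _ ⟨_, ⟨i, rfl⟩, rfl⟩
    exact isHomogeneous_killCompl hb (hg i)
  have hVJ : (V : Set (MvPolynomial (Fin b) k)) ⊆
      (Ideal.span (Set.range g)).map (killCompl (R := k) (Fin.castLE_injective hb)) := by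
    rw [Ideal.map_span]
    exact Submodule.span_le_restrictScalars k (MvPolynomial (Fin b) k) _
  obtain ⟨q, hqV, hq⟩ := exists_regMod hd V hVd N fun i => by
    have h := Ideal.mem_map_of_mem (killCompl (R := k) (Fin.castLE_injective hb))
      (hN (X (Fin.castLE hb i) ^ N) (isHomogeneous_X_pow _ _))
    rw [map_pow, ← rename_X (R := k) (Fin.castLE hb), killCompl_rename_app, Ideal.map_span] at h
    exact Ideal.span_mono Submodule.subset_span h
  refine ⟨q, fun t => hVd (hqV t), hq, ?_⟩
  rw [prefixIdeal, bot_sup_eq, Ideal.span_le]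
  rintro _ ⟨t, -, rfl⟩
  exact hVJ (hqV t)

lemma prefixIdeal_eq_span_range {A : Type*} [CommRing A] {b : ℕ} (q : ℕ → A) :
    prefixIdeal ⊥ q b = Ideal.span (Set.range fun i : Fin b => q i) := by
  rw [prefixIdeal, bot_sup_eq]
  congr 1
  ext x
  simp only [Set.mem_image, Set.mem_Iio, Set.mem_range]
  exact ⟨fun ⟨t, ht, h⟩ => ⟨⟨t, ht⟩, h⟩, fun ⟨t, h⟩ => ⟨t, t.2, h⟩⟩

end Restriction

end BalancedCI

/-- Under the hypotheses of Lemma 4.3 (balanced complete intersection `I` of type `(d)^n`,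
weights `w_1 ≤ … ≤ w_n` not all zero summing to `0` with `w_a < w_{a+1} = … = w_n`, and
every monomial of degree `n(d-1)` of positive `w`-weight lying in `I`), the image of `I`
in `k[x_1,…,x_a]` under setting `x_{a+1} = … = x_n = 0` is a balanced complete
intersection ideal of type `(d)^a`. -/
theorem stmt4 {k : Type*} [Field k] [CharZero k] {n d : ℕ} (hd : 2 ≤ d)
    (g : Fin n → MvPolynomial (Fin n) k)
    (hhom : ∀ i, (g i).IsHomogeneous d)
    (hreg : RingTheory.Sequence.IsRegular (MvPolynomial (Fin n) k) (List.ofFn g))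
    (w : Fin n → ℤ) (hw0 : w ≠ 0) (hwsum : ∑ i, w i = 0) (hwmono : Monotone w)
    (a : ℕ) (ha1 : 1 ≤ a) (ha2 : a ≤ n - 1)
    (hlt : ∀ i j : Fin n, (i : ℕ) < a → a ≤ (j : ℕ) → w i < w j)
    (heq : ∀ i j : Fin n, a ≤ (i : ℕ) → a ≤ (j : ℕ) → w i = w j)
    (hlimit : ∀ c : Fin n →₀ ℕ, (∑ i, c i) = n * (d - 1) →
      0 < (∑ i, w i * (c i : ℤ)) → monomial c (1 : k) ∈ Ideal.span (Set.range g)) :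
    ∃ q : Fin a → MvPolynomial (Fin a) k,
      (∀ j, (q j).IsHomogeneous d) ∧
      RingTheory.Sequence.IsRegular (MvPolynomial (Fin a) k) (List.ofFn q) ∧
      Ideal.map
        (aeval fun i : Fin n =>
          if h : (i : ℕ) < a then (X (⟨i, h⟩ : Fin a) : MvPolynomial (Fin a) k) else 0 :
            MvPolynomial (Fin n) k →ₐ[k] MvPolynomial (Fin a) k)
        (Ideal.span (Set.range g)) = Ideal.span (Set.range q) := by
  have hd0 : d ≠ 0 := by omega
  have han : a < n := by omega
  obtain ⟨G, hG, rfl⟩ : ∃ G : ℕ → MvPolynomial (Fin n) k, (∀ t, (G t).IsHomogeneous d) ∧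
      g = fun i : Fin n => G i := by
    refine ⟨fun t => if h : t < n then g ⟨t, h⟩ else 0, fun t => ?_, by simp⟩
    dsimp only
    split_ifs
    · exact hhom _
    · exact isHomogeneous_zero _ _ _
  have hGreg : BalancedCI.RegMod ⊥ G n :=
    (BalancedCI.isWeaklyRegular_ofFn_iff G).1 hreg.toIsWeaklyRegular
  have hfills := hGreg.fills hd0 hG
  have hnot := hGreg.not_fills hd0 hG
  rw [BalancedCI.prefixIdeal_eq_span_range] at hfills hnot
  set I := Ideal.span (Set.range fun i : Fin n => G i) with hI
  have hrestrict := fun (b : ℕ) (hb : b ≤ n) =>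
    BalancedCI.exists_regMod_killCompl hd0 _ hhom hfills hb
  have hstraight : ∀ b < n, BalancedCI.Straightens I b (b * (d - 1) + 1) := by
    intro b hb
    obtain ⟨q, hqd, hq, hqI⟩ := hrestrict b hb.le
    exact BalancedCI.straightens_span_of_fills hhom hb.le fun z hz => hqI (hq.fills hd0 hqd z hz)
  have hnotfills : ¬ BalancedCI.Fills (a * (d - 1))
      (I.map (killCompl (R := k) (Fin.castLE_injective han.le))) := by
    intro hfillsa
    obtain ⟨m, hmdeg, hmI⟩ : ∃ m : Fin n →₀ ℕ, m.degree = n * (d - 1) ∧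
        monomial m (1 : k) ∉ I := by
      by_contra! hcon
      refine hnot fun z hz => ?_
      rw [z.as_sum]
      refine sum_mem fun m hm => ?_
      rw [← mul_one (coeff m z), ← C_mul_monomial]
      refine I.mul_mem_left _ (hcon m ?_)
      rw [hz.degree_eq_sum_deg_support hm, Finsupp.degree_apply]
    have hapos : 1 ≤ a * (d - 1) := Nat.mul_pos ha1 (by omega)
    obtain ⟨m', hm'I, hm'deg, hm'⟩ := BalancedCI.exists_monomial_notMem
      (Function.update (fun b => b * (d - 1)) a (a * (d - 1) - 1)) (fun b hb => by
        rcases eq_or_ne b a with rfl | hba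
        · rw [Function.update_self, Nat.sub_add_cancel hapos]
          exact BalancedCI.straightens_span_of_fills hhom han.le hfillsa
        · rw [Function.update_of_ne hba]
          exact hstraight b hb) hmI
    have hm'a := hm' a han
    rw [Function.update_self] at hm'a
    refine hm'I (hlimit m' (by rw [← Finsupp.degree_eq_sum, hm'deg, hmdeg])
      (BalancedCI.weight_pos w hwsum hwmono ha1 han (hlt _ _ ?_ le_rfl) m' (hm'deg.trans hmdeg)
        (fun b hb => ?_) (by omega)))
    · exact Nat.sub_one_lt_of_lt ha1
    · rcases eq_or_ne b a with rfl | hba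
      · omega
      · simpa only [Function.update_of_ne hba] using hm' b hb
  obtain ⟨q, hqd, hq, hqI⟩ := hrestrict a han.le
  refine ⟨fun i => q i, fun i => hqd i, ?_, ?_⟩
  · rw [RingTheory.Sequence.isRegular_iff, BalancedCI.isWeaklyRegular_ofFn_iff]
    refine ⟨hq, fun htop => hq.not_fills hd0 hqd fun z _ => ?_⟩
    have h := BalancedCI.ofList_take_ofFn q (le_refl a)
    rw [List.take_of_length_le (by simp)] at h
    rw [← h, ← Ideal.mul_top (Ideal.ofList _), ← smul_eq_mul, ← htop]
    trivial
  · rw [BalancedCI.aeval_eq_killCompl han.le, ← BalancedCI.prefixIdeal_eq_span_range]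
    refine le_antisymm ?_ hqI
    rw [hI, Ideal.map_span, Ideal.span_le]
    rintro _ ⟨_, ⟨i, rfl⟩, rfl⟩
    by_contra hmem
    refine hnotfills (hq.fills_of_notMem hd0 hqd hqI ?_
      (BalancedCI.isHomogeneous_killCompl han.le (hhom i))
      (Ideal.mem_map_of_mem _ (Ideal.subset_span ⟨i, rfl⟩)) hmem)
    have := Nat.mul_le_mul_right (d - 1) ha1
    omega
end

section
/- Every homogeneous polynomial of degree (n−a)(d−1)+1 in the variables x_{a+1},…,x_n alone lies in I; that is, k[x_{a+1},…,x_n]_{(n−a)(d−1)+1} ⊆ I. -/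
open MvPolynomial

section Avoidance

variable {k S : Type*} [Field k] [Infinite k] [CommRing S] [Algebra k S]

/-- Prime avoidance for linear subspaces over an infinite field. -/
lemma exists_mem_forall_notMem_of_not_le (V : Submodule k S) {T : Set (Ideal S)} (hT : T.Finite)
    (h : ∀ P ∈ T, ¬ V ≤ P.restrictScalars k) : ∃ v ∈ V, ∀ P ∈ T, v ∉ P := by
  have := hT.to_subtype
  obtain ⟨v, hv⟩ := Submodule.exists_forall_notMem_of_forall_ne_top
    (fun P : T => (P.1.restrictScalars k).comap V.subtype) fun P hP =>
      h P.1 P.2 fun x hx => by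
        have : (⟨x, hx⟩ : V) ∈ (P.1.restrictScalars k).comap V.subtype := hP ▸ Submodule.mem_top
        exact this
  exact ⟨v, v.2, fun P hP => hv ⟨P, hP⟩⟩

/-- A subspace not contained in any prime of the form `J i : s`, for finitely many ideals `J i`,
contains an element that is a nonzerodivisor modulo each of the `J i`. -/
lemma exists_mem_forall_nonzerodivisor [IsNoetherianRing S] (V : Submodule k S)
    (J : ℕ → Ideal S) (r : ℕ)
    (h : ∀ i < r, ∀ P : Ideal S, P.IsPrime → V ≤ P.restrictScalars k →
      ∀ s, ¬ ∀ x, x ∈ P ↔ x * s ∈ J i) :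
    ∃ v ∈ V, ∀ i < r, ∀ u, v * u ∈ J i → u ∈ J i := by
  obtain ⟨v, hv, hvT⟩ := exists_mem_forall_notMem_of_not_le V
    (T := ⋃ i ∈ Set.Iio r, associatedPrimes S (S ⧸ J i))
    ((Set.finite_Iio r).biUnion fun i _ => associatedPrimes.finite S (S ⧸ J i)) (by
      intro P hP hVP
      obtain ⟨i, hi, hP⟩ := Set.mem_iUnion₂.1 hP
      rw [AssociatedPrimes.mem_iff, isAssociatedPrime_iff] at hP
      obtain ⟨hprime, x, hx⟩ := hP
      obtain ⟨s, rfl⟩ := Ideal.Quotient.mk_surjective x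
      refine h i hi P hprime hVP s fun x => ?_
      rw [hx, Submodule.mem_colon_singleton, Submodule.mem_bot, Algebra.smul_def,
        Ideal.Quotient.algebraMap_eq, ← map_mul, Ideal.Quotient.eq_zero_iff_mem])
  refine ⟨v, hv, fun i hi u hu => ?_⟩
  by_contra hu'
  have hmem : v ∈ ⋃ p ∈ associatedPrimes S (S ⧸ J i), (p : Set S) := by
    rw [biUnion_associatedPrimes_eq_zero_divisors]
    refine ⟨Ideal.Quotient.mk _ u, by rwa [Ne, Ideal.Quotient.eq_zero_iff_mem], ?_⟩
    rwa [Algebra.smul_def, Ideal.Quotient.algebraMap_eq, ← map_mul,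
      Ideal.Quotient.eq_zero_iff_mem]
  obtain ⟨P, hP, hvP⟩ := Set.mem_iUnion₂.1 hmem
  exact hvT P (Set.mem_biUnion hi hP) hvP

end Avoidance

section InitialIdeal

variable {S : Type*} [CommRing S]

/-- The ideal generated by the first `r` terms of a sequence. -/
def initialIdeal (f : ℕ → S) (r : ℕ) : Ideal S := Ideal.span (Set.image f (Set.Iio r))

/-- The first `r` terms of `f` form a weakly regular sequence. -/
def RegularUpTo (f : ℕ → S) (r : ℕ) : Prop :=
  ∀ i < r, ∀ u, f i * u ∈ initialIdeal f i → u ∈ initialIdeal f i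

lemma RegularUpTo.mono {f : ℕ → S} {r r' : ℕ} (h : RegularUpTo f r) (hr : r' ≤ r) :
    RegularUpTo f r' := fun i hi => h i (hi.trans_le hr)

@[simp]
lemma initialIdeal_zero (f : ℕ → S) : initialIdeal f 0 = ⊥ := by
  simp [initialIdeal]

lemma initialIdeal_succ (f : ℕ → S) (r : ℕ) :
    initialIdeal f (r + 1) = initialIdeal f r ⊔ Ideal.span {f r} := by
  rw [initialIdeal, initialIdeal, ← Ideal.span_union]
  congr 1
  ext x
  simp only [Set.mem_image, Set.mem_Iio, Set.mem_union, Set.mem_singleton_iff,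
    Order.lt_add_one_iff, le_iff_lt_or_eq]
  grind

lemma initialIdeal_congr {f f' : ℕ → S} {r : ℕ} (h : ∀ i < r, f i = f' i) :
    initialIdeal f r = initialIdeal f' r := by
  have himg : f '' Set.Iio r = f' '' Set.Iio r := Set.image_congr fun i hi => h i hi
  rw [initialIdeal, initialIdeal, himg]

lemma mem_sup_span_singleton_iff {J : Ideal S} {y x : S} :
    x ∈ J ⊔ Ideal.span {y} ↔ ∃ t, x - y * t ∈ J := by
  constructor
  · intro h
    obtain ⟨j, hj, z, hz, rfl⟩ := Submodule.mem_sup.1 h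
    obtain ⟨t, rfl⟩ := Ideal.mem_span_singleton'.1 hz
    exact ⟨t, by convert hj using 1; ring⟩
  · rintro ⟨t, ht⟩
    rw [← sub_add_cancel x (y * t)]
    exact add_mem (Ideal.mem_sup_left ht)
      (Ideal.mem_sup_right (Ideal.mul_mem_right _ _ (Ideal.mem_span_singleton_self y)))

/-- Exchanging the roles of two nonzerodivisors `f` and `l` modulo `J` carries `(J, f) : x` to
`(J, l) : x`. -/
lemma mul_mem_sup_of_exchange {J : Ideal S} {f l s t x : S} (hf : ∀ u, f * u ∈ J → u ∈ J)
    (hst : l * s - f * t ∈ J) (hx : x * s ∈ J ⊔ Ideal.span {f}) :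
    x * t ∈ J ⊔ Ideal.span {l} := by
  obtain ⟨u, hu⟩ := mem_sup_span_singleton_iff.1 hx
  refine mem_sup_span_singleton_iff.2 ⟨u, hf _ ?_⟩
  convert sub_mem (J.mul_mem_left l hu) (J.mul_mem_left x hst) using 1
  ring

lemma mem_sup_of_exchange {J : Ideal S} {f l s t : S} (hl : ∀ u, l * u ∈ J → u ∈ J)
    (hst : l * s - f * t ∈ J) (ht : t ∈ J ⊔ Ideal.span {l}) : s ∈ J ⊔ Ideal.span {f} := by
  obtain ⟨v, hv⟩ := mem_sup_span_singleton_iff.1 ht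
  refine mem_sup_span_singleton_iff.2 ⟨v, hl _ ?_⟩
  convert add_mem hst (J.mul_mem_left f hv) using 1
  ring

lemma mem_initialIdeal_map_iff {S' : Type*} [CommRing S'] {φ : S →+* S'}
    (hφ : Function.Surjective φ) {l : S} (hker : RingHom.ker φ = Ideal.span {l}) (f : ℕ → S)
    (r : ℕ) (u : S) :
    φ u ∈ initialIdeal (φ ∘ f) r ↔ u ∈ initialIdeal f r ⊔ Ideal.span {l} := by
  rw [initialIdeal, Set.image_comp, ← Ideal.map_span, ← Ideal.mem_comap,
    Ideal.comap_map_of_surjective' φ hφ, hker, initialIdeal]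

lemma RegularUpTo.map {S' : Type*} [CommRing S'] {φ : S →+* S'}
    (hφ : Function.Surjective φ) {l : S} (hker : RingHom.ker φ = Ideal.span {l}) {f : ℕ → S}
    {r : ℕ} (hf : RegularUpTo f r)
    (hl : ∀ i < r + 1, ∀ u, l * u ∈ initialIdeal f i → u ∈ initialIdeal f i) :
    RegularUpTo (φ ∘ f) r := by
  intro i hi u' hu
  obtain ⟨u, rfl⟩ := hφ u'
  rw [Function.comp_apply, ← map_mul, mem_initialIdeal_map_iff hφ hker] at hu
  rw [mem_initialIdeal_map_iff hφ hker]
  obtain ⟨v, hv⟩ := mem_sup_span_singleton_iff.1 hu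
  have hv' : v ∈ initialIdeal f (i + 1) := by
    refine hl (i + 1) (by omega) v ?_
    rw [initialIdeal_succ]
    refine mem_sup_span_singleton_iff.2 ⟨u, ?_⟩
    rw [← neg_mem_iff]
    convert hv using 1
    ring
  rw [initialIdeal_succ] at hv'
  obtain ⟨t, ht⟩ := mem_sup_span_singleton_iff.1 hv'
  refine mem_sup_span_singleton_iff.2 ⟨t, hf i hi _ ?_⟩
  convert add_mem hv ((initialIdeal f i).mul_mem_left l ht) using 1
  ring

end InitialIdeal

section Homogeneous

variable {σ k : Type*} [Field k]

lemma homogeneousComponent_mul_of_isHomogeneous {f : MvPolynomial σ k} {d : ℕ}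
    (hf : f.IsHomogeneous d) (t : MvPolynomial σ k) (m : ℕ) :
    homogeneousComponent m (f * t) = if d ≤ m then f * homogeneousComponent (m - d) t else 0 := by
  conv_lhs => rw [← sum_homogeneousComponent t, Finset.mul_sum, map_sum]
  have hterm : ∀ i, homogeneousComponent m (f * homogeneousComponent i t) =
      if m = d + i then f * homogeneousComponent i t else 0 := fun i =>
    homogeneousComponent_of_mem (hf.mul (homogeneousComponent_isHomogeneous i t))
  simp_rw [hterm]
  split_ifs with h
  · rw [Finset.sum_eq_single (m - d)]
    · rw [if_pos (by omega)]
    · intro i _ hi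
      rw [if_neg (by omega)]
    · intro hi
      rw [if_pos (by omega), homogeneousComponent_eq_zero _ _ (by
        rw [Finset.mem_range] at hi; omega), mul_zero]
  · exact Finset.sum_eq_zero fun i _ => if_neg (by omega)

attribute [local instance] MvPolynomial.gradedAlgebra

lemma isHomogeneous_span_of_isHomogeneous {A : Set (MvPolynomial σ k)} {d : ℕ}
    (h : ∀ f ∈ A, f.IsHomogeneous d) :
    (Ideal.span A).IsHomogeneous (homogeneousSubmodule σ k) :=
  Ideal.homogeneous_span _ _ fun f hf => ⟨d, h f hf⟩

lemma exists_isHomogeneous_sub_mul_mem {J : Ideal (MvPolynomial σ k)}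
    (hJ : J.IsHomogeneous (homogeneousSubmodule σ k)) {f s t : MvPolynomial σ k} {d e : ℕ}
    (hf : f.IsHomogeneous d) (hs : s.IsHomogeneous e) (h : s - f * t ∈ J) :
    s ∈ J ∨ ∃ e' t', e' + d = e ∧ t'.IsHomogeneous e' ∧ s - f * t' ∈ J := by
  have hcomp := homogeneousComponent_mem_of_mem hJ h e
  rw [map_sub, homogeneousComponent_eq_self hs,
    homogeneousComponent_mul_of_isHomogeneous hf] at hcomp
  split_ifs at hcomp with hde
  · exact .inr ⟨e - d, _, by omega, homogeneousComponent_isHomogeneous _ _, hcomp⟩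
  · simp only [sub_zero] at hcomp
    exact .inl hcomp

/-- Dividing a polynomial ring by a nonzero linear form gives a polynomial ring in one variable
less. -/
lemma exists_algHom_ker_eq_span_linear {n : ℕ} {l : MvPolynomial (Fin (n + 1)) k}
    (hl : l.IsHomogeneous 1) (hl0 : l ≠ 0) :
    ∃ φ : MvPolynomial (Fin (n + 1)) k →ₐ[k] MvPolynomial (Fin n) k,
      Function.Surjective φ ∧ RingHom.ker (φ : _ →+* MvPolynomial (Fin n) k) = Ideal.span {l} ∧
      (∀ p e, p.IsHomogeneous e → (φ p).IsHomogeneous e) ∧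
      ∀ j, ∃ i, φ (X i) = X j := by
  have hl' := (mem_homogeneousSubmodule 1 l).2 hl
  rw [homogeneousSubmodule_one_eq_span_X, Submodule.mem_span_range_iff_exists_fun] at hl'
  obtain ⟨c, rfl⟩ := hl'
  obtain ⟨j₀, hj₀⟩ : ∃ j, c j ≠ 0 := by
    by_contra! h
    simp [h] at hl0
  let v : Fin (n + 1) → MvPolynomial (Fin n) k :=
    j₀.insertNth (-∑ i, (c (j₀.succAbove i) / c j₀) • X i) X
  have hv : ∀ i, (v i).IsHomogeneous 1 := by
    intro i
    rcases Fin.eq_self_or_eq_succAbove j₀ i with rfl | ⟨i, rfl⟩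
    · simp only [v, Fin.insertNth_apply_same]
      refine (IsHomogeneous.sum _ _ _ fun i _ => ?_).neg
      rw [smul_eq_C_mul]
      exact isHomogeneous_C_mul_X _ _
    · simp only [v, Fin.insertNth_apply_succAbove]
      exact isHomogeneous_X _ _
  have hX : ∀ i, aeval v (X (j₀.succAbove i) : MvPolynomial (Fin (n + 1)) k) = X i := by
    intro i
    simp [v]
  have hsec : ∀ q, aeval v (rename j₀.succAbove q : MvPolynomial (Fin (n + 1)) k) = q := by
    intro q
    rw [aeval_rename]
    have : v ∘ j₀.succAbove = X := by
      ext1 i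
      simp [v]
    rw [this, aeval_X_left_apply]
  refine ⟨aeval v, fun q => ⟨_, hsec q⟩, ?_, fun p e hp => by simpa using hp.aeval v hv,
    fun j => ⟨_, hX j⟩⟩
  have hlv : aeval v (∑ i, c i • X i : MvPolynomial (Fin (n + 1)) k) = 0 := by
    rw [map_sum, Fin.sum_univ_succAbove _ j₀]
    simp only [map_smul, hX]
    simp [v, Finset.smul_sum, smul_smul, mul_div_cancel₀ _ hj₀]
  refine le_antisymm (fun p hp => ?_) ?_
  · have key : ((Ideal.Quotient.mkₐ k (Ideal.span {∑ i, c i • X i})).comp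
        ((rename j₀.succAbove).comp (aeval v))) =
        Ideal.Quotient.mkₐ k (Ideal.span {∑ i, c i • (X i : MvPolynomial (Fin (n + 1)) k)}) := by
      ext i
      rcases Fin.eq_self_or_eq_succAbove j₀ i with rfl | ⟨i, rfl⟩
      · simp only [AlgHom.comp_apply, aeval_X, Ideal.Quotient.mkₐ_eq_mk]
        rw [eq_comm, Ideal.Quotient.eq, Ideal.mem_span_singleton']
        refine ⟨C (c i)⁻¹, ?_⟩
        rw [Fin.sum_univ_succAbove _ i]
        simp only [v, Fin.insertNth_apply_same, map_neg, map_sum, map_smul, rename_X,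
          sub_neg_eq_add, ← smul_eq_C_mul, smul_add, Finset.smul_sum, smul_smul,
          inv_mul_cancel₀ hj₀, one_smul, div_eq_inv_mul]
      · simp only [AlgHom.comp_apply, hX, rename_X]
    have := AlgHom.congr_fun key p
    have hp' : aeval v p = 0 := hp
    rw [AlgHom.comp_apply, AlgHom.comp_apply, hp', map_zero, map_zero, eq_comm,
      Ideal.Quotient.mkₐ_eq_mk, Ideal.Quotient.eq_zero_iff_mem] at this
    exact this
  · rw [Ideal.span_le, Set.singleton_subset_iff]
    exact hlv

end Homogeneous

section RegularSequences

attribute [local instance] MvPolynomial.gradedAlgebra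

variable {k : Type*} [Field k]

lemma isHomogeneous_initialIdeal {σ : Type*} {f : ℕ → MvPolynomial σ k} {d : ℕ}
    (hf : ∀ i, (f i).IsHomogeneous d) (r : ℕ) :
    (initialIdeal f r).IsHomogeneous (homogeneousSubmodule σ k) :=
  isHomogeneous_span_of_isHomogeneous (d := d) (by rintro _ ⟨i, -, rfl⟩; exact hf i)

lemma mul_mem_of_forall_X_mul_mem {σ : Type*} {J : Ideal (MvPolynomial σ k)}
    {l s : MvPolynomial σ k} (hl : l.IsHomogeneous 1) (h : ∀ j, X j * s ∈ J) : l * s ∈ J := by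
  have hl' := (mem_homogeneousSubmodule 1 l).2 hl
  rw [homogeneousSubmodule_one_eq_span_X] at hl'
  clear hl
  induction hl' using Submodule.span_induction with
  | mem x hx => obtain ⟨j, rfl⟩ := hx; exact h j
  | zero => simp
  | add x y _ _ hx hy => rw [add_mul]; exact add_mem hx hy
  | smul c x _ hx =>
    rw [smul_eq_C_mul, mul_assoc]
    exact J.mul_mem_left _ hx

/-- Multiplication by `f` is onto in high degrees modulo `(J, f)` when it is injective modulo `J`
and some linear form is injective modulo `J` and onto in those degrees. -/
lemma mem_sup_of_linear_onto {n d D e : ℕ} {J : Ideal (MvPolynomial (Fin n) k)}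
    {l f : MvPolynomial (Fin n) k}
    (hl : l.IsHomogeneous 1) (hf : f.IsHomogeneous d) (hlJ : ∀ u, l * u ∈ J → u ∈ J)
    (hfJ : ∀ u, f * u ∈ J → u ∈ J)
    (honto : ∀ e > D, ∀ s : MvPolynomial (Fin n) k, s.IsHomogeneous e →
      ∃ t : MvPolynomial (Fin n) k, t.IsHomogeneous (e - 1) ∧ s - l * t ∈ J)
    (he : D + d ≤ e) {s : MvPolynomial (Fin n) k} (hs : s.IsHomogeneous e) :
    s ∈ J ⊔ Ideal.span {f} := by
  let q := (Ideal.Quotient.mkₐ k J).toLinearMap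
  let R : ℕ → Submodule k (MvPolynomial (Fin n) k ⧸ J) := fun e =>
    (homogeneousSubmodule (Fin n) k e).map q
  have hfin : ∀ e, FiniteDimensional k (R e) := fun e =>
    have : FiniteDimensional k (homogeneousSubmodule (Fin n) k e) :=
      Module.Finite.iff_fg.2 (homogeneousSubmodule_fg (Fin n) k e)
    inferInstance
  have hinj : ∀ g : MvPolynomial (Fin n) k, (∀ u, g * u ∈ J → u ∈ J) →
      Function.Injective (LinearMap.mulLeft k (q g)) := by
    intro g hg
    rw [injective_iff_map_eq_zero]
    intro x hx
    obtain ⟨u, rfl⟩ := Ideal.Quotient.mk_surjective x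
    rw [Ideal.Quotient.eq_zero_iff_mem]
    refine hg u ?_
    rw [← Ideal.Quotient.eq_zero_iff_mem, map_mul]
    exact hx
  have hle : ∀ (g : MvPolynomial (Fin n) k) (c e : ℕ), g.IsHomogeneous c →
      (R e).map (LinearMap.mulLeft k (q g)) ≤ R (c + e) := by
    rintro g c e hg _ ⟨_, ⟨u, hu, rfl⟩, rfl⟩
    exact ⟨g * u, hg.mul hu, map_mul (Ideal.Quotient.mk J) g u⟩
  have hrank : ∀ e ≥ D, Module.finrank k (R e) = Module.finrank k (R D) := by
    intro e he
    induction e, he using Nat.le_induction with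
    | base => rfl
    | succ e he ih =>
      have hmap : R (e + 1) = (R e).map (LinearMap.mulLeft k (q l)) := by
        refine le_antisymm ?_ (by rw [add_comm]; exact hle l 1 e hl)
        rintro _ ⟨u, hu, rfl⟩
        obtain ⟨t, ht, htJ⟩ := honto (e + 1) (by omega) u hu
        refine ⟨q t, ⟨t, ht, rfl⟩, ?_⟩
        exact ((Ideal.Quotient.eq.2 htJ).trans (map_mul (Ideal.Quotient.mk J) l t)).symm
      rw [← ih, (Submodule.equivMapOfInjective _ (hinj l hlJ) (R e)).finrank_eq, hmap]
  have heq : (R (e - d)).map (LinearMap.mulLeft k (q f)) = R e := by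
    refine Submodule.eq_of_le_of_finrank_eq ?_ ?_
    · have := hle f d (e - d) hf
      rwa [show d + (e - d) = e by omega] at this
    · rw [← (Submodule.equivMapOfInjective _ (hinj f hfJ) (R (e - d))).finrank_eq,
        hrank (e - d) (by omega), hrank e (by omega)]
  have hsR : q s ∈ R e := ⟨s, hs, rfl⟩
  rw [← heq] at hsR
  obtain ⟨_, ⟨t, -, rfl⟩, ht⟩ := hsR
  refine mem_sup_span_singleton_iff.2 ⟨t, ?_⟩
  rw [← Ideal.Quotient.eq, map_mul]
  exact ht.symm

variable [Infinite k]

lemma exists_linear_nonzerodivisor {n : ℕ} {f : ℕ → MvPolynomial (Fin n) k} {r : ℕ}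
    (hsoc : ∀ i < r, ∀ s, (∀ j, X j * s ∈ initialIdeal f i) → s ∈ initialIdeal f i) :
    ∃ l : MvPolynomial (Fin n) k, l.IsHomogeneous 1 ∧
      ∀ i < r, ∀ u, l * u ∈ initialIdeal f i → u ∈ initialIdeal f i := by
  refine exists_mem_forall_nonzerodivisor (homogeneousSubmodule (Fin n) k 1) (initialIdeal f) r ?_
  intro i hi P hP hV s hs
  have h1 := hsoc i hi s fun j => (hs _).1 (hV (isHomogeneous_X k j))
  exact hP.ne_top (P.eq_top_iff_one.2 ((hs 1).2 (by rwa [one_mul])))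

/-- Passing to a generic hyperplane section. -/
lemma exists_hyperplane_section {n r : ℕ} {f : ℕ → MvPolynomial (Fin (n + 1)) k}
    (hreg : RegularUpTo f r)
    (hsoc : ∀ i < r + 1, ∀ s, (∀ j, X j * s ∈ initialIdeal f i) → s ∈ initialIdeal f i) :
    ∃ (l : MvPolynomial (Fin (n + 1)) k)
      (φ : MvPolynomial (Fin (n + 1)) k →+* MvPolynomial (Fin n) k),
      l.IsHomogeneous 1 ∧ (∀ i < r + 1, ∀ u, l * u ∈ initialIdeal f i → u ∈ initialIdeal f i) ∧
      (∀ p e, p.IsHomogeneous e → (φ p).IsHomogeneous e) ∧ (∀ j, ∃ i, φ (X i) = X j) ∧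
      RegularUpTo (φ ∘ f) r ∧
      ∀ i u, φ u ∈ initialIdeal (φ ∘ f) i ↔ u ∈ initialIdeal f i ⊔ Ideal.span {l} := by
  obtain ⟨l, hl, hnzd⟩ := exists_linear_nonzerodivisor hsoc
  have hl0 : l ≠ 0 := by
    rintro rfl
    have := hnzd 0 (by omega) 1 (by simp)
    simp at this
  obtain ⟨φ, hφ, hker, hhom, hX⟩ := exists_algHom_ker_eq_span_linear hl hl0
  exact ⟨l, φ, hl, hnzd, hhom, hX, hreg.map hφ hker hnzd, mem_initialIdeal_map_iff hφ hker f⟩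

/-- A regular sequence of fewer than `n` forms in `n` variables has depth left over: no nonzero
class modulo it is killed by all the variables. -/
lemma mem_initialIdeal_of_forall_X_mul_mem {n r : ℕ} (hr : r < n)
    {f : ℕ → MvPolynomial (Fin n) k} (hreg : RegularUpTo f r) {s : MvPolynomial (Fin n) k}
    (hs : ∀ j, X j * s ∈ initialIdeal f r) : s ∈ initialIdeal f r := by
  induction n generalizing r with
  | zero => omega
  | succ n ihn =>
    induction r using Nat.strong_induction_on generalizing s with
    | _ r ihr =>
      cases r with
      | zero => simpa using hs 0
      | succ r =>
        obtain ⟨l, φ, hl, hnzd, -, hX, hregφ, hmem⟩ := exists_hyperplane_section (r := r)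
          (hreg.mono (by omega)) fun i hi s hs =>
            ihr i hi (by omega) (hreg.mono (by omega)) hs
        have hls := mul_mem_of_forall_X_mul_mem hl hs
        rw [initialIdeal_succ] at hls hs ⊢
        obtain ⟨t, ht⟩ := mem_sup_span_singleton_iff.1 hls
        refine mem_sup_of_exchange (hnzd r (by omega)) ht ((hmem r t).1 ?_)
        refine ihn (by omega) hregφ fun j => ?_
        obtain ⟨i, hi⟩ := hX j
        rw [← hi, ← map_mul, hmem]
        exact mul_mem_sup_of_exchange (hreg r (by omega)) ht (hs i)

lemma exists_hyperplane_section_of_regularUpTo {n r : ℕ}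
    {f : ℕ → MvPolynomial (Fin (n + 1)) k} (hreg : RegularUpTo f r) (hr : r ≤ n) :
    ∃ (l : MvPolynomial (Fin (n + 1)) k)
      (φ : MvPolynomial (Fin (n + 1)) k →+* MvPolynomial (Fin n) k),
      l.IsHomogeneous 1 ∧ (∀ i < r + 1, ∀ u, l * u ∈ initialIdeal f i → u ∈ initialIdeal f i) ∧
      (∀ p e, p.IsHomogeneous e → (φ p).IsHomogeneous e) ∧ (∀ j, ∃ i, φ (X i) = X j) ∧
      RegularUpTo (φ ∘ f) r ∧
      ∀ i u, φ u ∈ initialIdeal (φ ∘ f) i ↔ u ∈ initialIdeal f i ⊔ Ideal.span {l} :=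
  exists_hyperplane_section hreg fun _ _ _ hs =>
    mem_initialIdeal_of_forall_X_mul_mem (by omega) (hreg.mono (by omega)) hs

/-- The socle of a complete intersection of type `(d)^n` lives in degree `n(d-1)`. -/
lemma mem_initialIdeal_or_degree_eq {n d : ℕ} (hd : 1 ≤ d)
    {f : ℕ → MvPolynomial (Fin n) k} (hf : ∀ i, (f i).IsHomogeneous d)
    (hreg : RegularUpTo f n) {s : MvPolynomial (Fin n) k} {e : ℕ} (hse : s.IsHomogeneous e)
    (hs : ∀ j, X j * s ∈ initialIdeal f n) : s ∈ initialIdeal f n ∨ e = n * (d - 1) := by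
  induction n generalizing e with
  | zero =>
    by_cases h0 : s = 0
    · simp [h0]
    · exact .inr (by simpa using hse.inj_right (isHomogeneous_of_isEmpty _ _ s) h0)
  | succ n ih =>
    obtain ⟨l, φ, hl, hnzd, hhom, hX, hregφ, hmem⟩ :=
      exists_hyperplane_section_of_regularUpTo (hreg.mono n.le_succ) le_rfl
    have hls := mul_mem_of_forall_X_mul_mem hl hs
    rw [initialIdeal_succ] at hls hs ⊢
    obtain ⟨t, ht⟩ := mem_sup_span_singleton_iff.1 hls
    rcases exists_isHomogeneous_sub_mul_mem (isHomogeneous_initialIdeal hf n) (hf n)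
      (hl.mul hse) ht with h | ⟨e', t', he', ht', ht⟩
    · exact .inl (Ideal.mem_sup_left (hnzd n (by omega) s h))
    · have hsoc : ∀ j, X j * φ t' ∈ initialIdeal (φ ∘ f) n := by
        intro j
        obtain ⟨i, hi⟩ := hX j
        rw [← hi, ← map_mul, hmem]
        exact mul_mem_sup_of_exchange (hreg n (by omega)) ht (hs i)
      rcases ih (fun i => hhom _ _ (hf i)) hregφ (hhom _ _ ht') hsoc with h | h
      · exact .inl (mem_sup_of_exchange (hnzd n (by omega)) ht ((hmem n t').1 h))
      · right
        rw [Nat.succ_mul, ← h]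
        omega

/-- A complete intersection of type `(d)^n` contains all forms of degree above `n(d-1)`. -/
lemma mem_initialIdeal_of_degree_gt {n d : ℕ} (hd : 1 ≤ d)
    {f : ℕ → MvPolynomial (Fin n) k} (hf : ∀ i, (f i).IsHomogeneous d)
    (hreg : RegularUpTo f n) {s : MvPolynomial (Fin n) k} {e : ℕ} (he : n * (d - 1) < e)
    (hs : s.IsHomogeneous e) : s ∈ initialIdeal f n := by
  induction n generalizing e with
  | zero =>
    have h0 : s = 0 := by
      by_contra h0
      have := hs.inj_right (isHomogeneous_of_isEmpty _ _ s) h0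
      omega
    simp [h0]
  | succ n ih =>
    obtain ⟨l, φ, hl, hnzd, hhom, hX, hregφ, hmem⟩ :=
      exists_hyperplane_section_of_regularUpTo (hreg.mono n.le_succ) le_rfl
    rw [initialIdeal_succ]
    refine mem_sup_of_linear_onto (D := n * (d - 1)) hl (hf n) (hnzd n (by omega))
      (hreg n (by omega)) ?_ (by rw [Nat.succ_mul] at he; omega) hs
    intro e he s hs
    have hφs := ih (fun i => hhom _ _ (hf i)) hregφ he (hhom _ _ hs)
    obtain ⟨t, ht⟩ := mem_sup_span_singleton_iff.1 ((hmem n s).1 hφs)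
    rcases exists_isHomogeneous_sub_mul_mem (isHomogeneous_initialIdeal hf n) hl hs ht with
      h | ⟨e', t', he', ht', ht⟩
    · exact ⟨0, isHomogeneous_zero _ _ _, by simpa using h⟩
    · subst he'
      exact ⟨t', ht', ht⟩

/-- Forms of degree above `n(d-1)` in `n` variables lie in any ideal that is primary to the
irrelevant ideal and generated by forms of degree `d`. -/
lemma mem_span_of_degree_gt {n d : ℕ} (hd : 1 ≤ d) {A : Set (MvPolynomial (Fin n) k)}
    (hA : ∀ f ∈ A, f.IsHomogeneous d) {N : ℕ} (hN : ∀ j, X j ^ N ∈ Ideal.span A)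
    {s : MvPolynomial (Fin n) k} {e : ℕ} (he : n * (d - 1) < e) (hs : s.IsHomogeneous e) :
    s ∈ Ideal.span A := by
  have hV : ∀ v ∈ Submodule.span k A, v.IsHomogeneous d := fun v hv =>
    (Submodule.span_le (p := homogeneousSubmodule (Fin n) k d)).2 hA hv
  have hVI : Submodule.span k A ≤ (Ideal.span A).restrictScalars k :=
    Submodule.span_le.2 Ideal.subset_span
  have key : ∀ r ≤ n, ∃ h : ℕ → MvPolynomial (Fin n) k,
      (∀ i, h i ∈ Submodule.span k A) ∧ RegularUpTo h r := by
    intro r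
    induction r with
    | zero => exact fun _ => ⟨0, fun _ => zero_mem _, fun i hi => absurd hi (by omega)⟩
    | succ r ih =>
      intro hr
      obtain ⟨h, hhV, hh⟩ := ih (by omega)
      obtain ⟨v, hvV, hv⟩ := exists_mem_forall_nonzerodivisor (Submodule.span k A)
        (fun _ => initialIdeal h r) 1 (by
          intro _ _ P hP hAP s hs
          have hAP' : Ideal.span A ≤ P := Ideal.span_le.2 fun f hf => hAP (Submodule.subset_span hf)
          have hsJ : s ∈ initialIdeal h r := mem_initialIdeal_of_forall_X_mul_mem (by omega) hh
            fun j => (hs _).1 (hP.mem_of_pow_mem N (hAP' (hN j)))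
          exact hP.ne_top (P.eq_top_iff_one.2 ((hs 1).2 (by rwa [one_mul]))))
      have hcongr : ∀ i ≤ r, initialIdeal (Function.update h r v) i = initialIdeal h i :=
        fun i hi => initialIdeal_congr fun j hj => Function.update_of_ne (by omega) _ _
      refine ⟨Function.update h r v, fun i => ?_, fun i hi u hu => ?_⟩
      · rcases eq_or_ne i r with rfl | hi
        · rwa [Function.update_self]
        · rw [Function.update_of_ne hi]
          exact hhV i
      · rw [hcongr i (by omega)] at hu ⊢
        rcases eq_or_ne i r with rfl | hir
        · rw [Function.update_self] at hu
          exact hv 0 (by omega) u hu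
        · rw [Function.update_of_ne hir] at hu
          exact hh i (by omega) u hu
  obtain ⟨h, hhV, hh⟩ := key n le_rfl
  have hle : initialIdeal h n ≤ Ideal.span A := by
    rw [initialIdeal, Ideal.span_le]
    rintro _ ⟨i, -, rfl⟩
    exact hVI (hhV i)
  exact hle (mem_initialIdeal_of_degree_gt hd (fun i => hV _ (hhV i)) hh he hs)

end RegularSequences

section Lists

variable {S : Type*} [CommRing S]

lemma initialIdeal_getD_eq_ofList_take (rs : List S) {i : ℕ} (hi : i ≤ rs.length) :
    initialIdeal (fun j => rs.getD j 0) i = Ideal.ofList (rs.take i) := by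
  rw [initialIdeal, Ideal.ofList]
  congr 1
  ext x
  simp only [Set.mem_image, Set.mem_Iio, Set.mem_ofPred_eq, List.mem_take_iff_getElem]
  constructor
  · rintro ⟨j, hj, rfl⟩
    exact ⟨j, by omega, by rw [List.getD_eq_getElem]⟩
  · rintro ⟨j, hj, rfl⟩
    exact ⟨j, by omega, by rw [List.getD_eq_getElem]⟩

lemma regularUpTo_getD_of_isWeaklyRegular {rs : List S}
    (h : RingTheory.Sequence.IsWeaklyRegular S rs) :
    RegularUpTo (fun j => rs.getD j 0) rs.length := by
  intro i hi u hu
  rw [initialIdeal_getD_eq_ofList_take rs hi.le] at hu ⊢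
  have hi' := h.regular_mod_prev i hi
  have htop : (Ideal.ofList (rs.take i) • ⊤ : Submodule S S) = Ideal.ofList (rs.take i) := by
    simp
  rw [htop] at hi'
  change rs.getD i 0 * u ∈ _ at hu
  rw [List.getD_eq_getElem _ _ hi] at hu
  rw [← Ideal.Quotient.eq_zero_iff_mem] at hu ⊢
  refine hi' ?_
  simp only [smul_zero]
  rw [← hu, map_mul]
  rfl

end Lists

section Monomials

attribute [local instance] MvPolynomial.gradedAlgebra

variable {k : Type*} [Field k]

lemma exists_mem_support_mul_monomial_notMem {σ : Type*} {I : Ideal (MvPolynomial σ k)}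
    {p q : MvPolynomial σ k} (h : p * q ∉ I) : ∃ c ∈ q.support, p * monomial c 1 ∉ I := by
  by_contra! hc
  refine h ?_
  rw [q.as_sum, Finset.mul_sum]
  refine sum_mem fun c hcq => ?_
  rw [← mul_one (coeff c q), ← C_mul_monomial, mul_left_comm]
  exact I.mul_mem_left _ (hc c hcq)

lemma sub_rename_killCompl_mem {σ τ : Type*} {f : σ → τ} (hf : Function.Injective f)
    (p : MvPolynomial τ k) :
    p - rename f (killCompl hf p) ∈
      Ideal.span (X '' (Set.range f)ᶜ : Set (MvPolynomial τ k)) := by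
  classical
  have key : (Ideal.Quotient.mkₐ k (Ideal.span (X '' (Set.range f)ᶜ))).comp
      ((rename f).comp (killCompl hf)) =
      Ideal.Quotient.mkₐ k (Ideal.span (X '' (Set.range f)ᶜ : Set (MvPolynomial τ k))) := by
    ext j
    by_cases hj : j ∈ Set.range f
    · obtain ⟨i, rfl⟩ := hj
      rw [AlgHom.comp_apply, AlgHom.comp_apply, ← rename_X f i, killCompl_rename_app]
    · have : killCompl hf (X j : MvPolynomial τ k) = 0 := by
        rw [killCompl, aeval_X, dif_neg hj]
      rw [AlgHom.comp_apply, AlgHom.comp_apply, this, map_zero, map_zero, eq_comm,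
        Ideal.Quotient.mkₐ_eq_mk, Ideal.Quotient.eq_zero_iff_mem]
      exact Ideal.subset_span ⟨j, hj, rfl⟩
  rw [← Ideal.Quotient.eq]
  exact (AlgHom.congr_fun key p).symm

lemma isHomogeneous_killCompl {σ τ : Type*} {f : σ → τ} (hf : Function.Injective f)
    {p : MvPolynomial τ k} {e : ℕ} (hp : p.IsHomogeneous e) :
    (killCompl hf p).IsHomogeneous e := by
  classical
  rw [← one_mul e]
  refine hp.aeval _ fun i => ?_
  split_ifs
  · exact isHomogeneous_X _ _
  · exact isHomogeneous_zero _ _ _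

/-- Modulo the ideal, a form of degree above `i(d-1)` can be rewritten using only monomials that
involve a variable of index at least `i`. -/
lemma exists_sub_mem_of_degree_gt [Infinite k] {n d : ℕ} (hd : 1 ≤ d)
    {A : Set (MvPolynomial (Fin n) k)} (hA : ∀ f ∈ A, f.IsHomogeneous d) {N : ℕ}
    (hN : ∀ j, X j ^ N ∈ Ideal.span A) {i : ℕ} (hi : i ≤ n) {u : MvPolynomial (Fin n) k} {e : ℕ}
    (he : i * (d - 1) < e) (hu : u.IsHomogeneous e) :
    ∃ z : MvPolynomial (Fin n) k, z.IsHomogeneous e ∧ u - z ∈ Ideal.span A ∧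
      ∀ c ∈ z.support, ∃ j : Fin n, i ≤ (j : ℕ) ∧ c j ≠ 0 := by
  have hinj := Fin.castLE_injective hi
  let φ : MvPolynomial (Fin n) k →+* MvPolynomial (Fin i) k := (killCompl hinj : _ →ₐ[k] _)
  have hφ : Function.Surjective φ := fun q => ⟨_, killCompl_rename_app hinj q⟩
  have hmem : φ u ∈ Ideal.map φ (Ideal.span A) := by
    rw [Ideal.map_span]
    refine mem_span_of_degree_gt hd (N := N) ?_ ?_ he (isHomogeneous_killCompl hinj hu)
    · rintro _ ⟨f, hf, rfl⟩
      exact isHomogeneous_killCompl hinj (hA f hf)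
    · intro j
      rw [← Ideal.map_span]
      have : φ (X (Fin.castLE hi j) ^ N) = X j ^ N := by
        rw [map_pow, ← rename_X (Fin.castLE hi)]
        exact congrArg (· ^ N) (killCompl_rename_app hinj (X j))
      rw [← this]
      exact Ideal.mem_map_of_mem φ (hN _)
  obtain ⟨v, hv, hvu⟩ := (Ideal.mem_map_iff_of_surjective φ hφ).1 hmem
  have hcomp : homogeneousComponent e (u - v) = u - homogeneousComponent e v := by
    rw [map_sub, homogeneousComponent_eq_self hu]
  refine ⟨homogeneousComponent e (u - v), homogeneousComponent_isHomogeneous _ _, ?_, ?_⟩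
  · rw [hcomp, sub_sub_cancel]
    exact homogeneousComponent_mem_of_mem (isHomogeneous_span_of_isHomogeneous hA) hv e
  · intro c hc
    rw [support_homogeneousComponent, Finset.mem_filter] at hc
    have hker : killCompl hinj (u - v) = 0 := by
      rw [map_sub, sub_eq_zero]
      exact hvu.symm
    have hspan := sub_rename_killCompl_mem hinj (u - v)
    rw [hker, map_zero, sub_zero, mem_ideal_span_X_image] at hspan
    obtain ⟨j, hj, hcj⟩ := hspan c hc.1
    refine ⟨j, ?_, hcj⟩
    by_contra! hji
    exact hj ⟨⟨j, hji⟩, rfl⟩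

/-- The total exponent of the first `i` variables in a monomial. -/
def initialDegree {n : ℕ} (c : Fin n →₀ ℕ) (i : ℕ) : ℕ := ∑ j with (j : Fin n).val < i, c j

lemma initialDegree_add {n : ℕ} (c c' : Fin n →₀ ℕ) (i : ℕ) :
    initialDegree (c + c') i = initialDegree c i + initialDegree c' i := by
  simp [initialDegree, Finset.sum_add_distrib]

lemma initialDegree_le_degree {n : ℕ} (c : Fin n →₀ ℕ) (i : ℕ) :
    initialDegree c i ≤ c.degree := by
  rw [Finsupp.degree_eq_sum]
  exact Finset.sum_le_sum_of_subset (Finset.filter_subset _ _)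

lemma initialDegree_lt_degree {n : ℕ} {c : Fin n →₀ ℕ} {i : ℕ} {j : Fin n} (hj : i ≤ (j : ℕ))
    (hc : c j ≠ 0) : initialDegree c i < c.degree := by
  rw [Finsupp.degree_eq_sum]
  exact Finset.sum_lt_sum_of_subset (Finset.filter_subset _ _) (Finset.mem_univ j)
    (by simpa using hj) (Nat.pos_of_ne_zero hc) fun _ _ _ => Nat.zero_le _

lemma initialDegree_eq_zero {n : ℕ} {c : Fin n →₀ ℕ} {i : ℕ}
    (hc : ∀ j : Fin n, (j : ℕ) < i → c j = 0) : initialDegree c i = 0 :=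
  Finset.sum_eq_zero fun j hj => hc j (by simpa using hj)

lemma initialDegree_eq_degree {n : ℕ} {c : Fin n →₀ ℕ} {i : ℕ}
    (hc : ∀ j : Fin n, i ≤ (j : ℕ) → c j = 0) : initialDegree c i = c.degree := by
  rw [Finsupp.degree_eq_sum, initialDegree]
  exact Finset.sum_subset (Finset.filter_subset _ _) fun j _ hj => hc j (by simpa using hj)

/-- If some monomial of degree `D` lies outside `I : p`, then so does one whose exponents satisfy
the dominance inequalities `c_1 + ⋯ + c_i ≤ i(d-1)` for all `i ≤ a`. -/
lemma exists_monomial_notMem_initialDegree_le [Infinite k] {n d : ℕ} (hd : 1 ≤ d)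
    {A : Set (MvPolynomial (Fin n) k)} (hA : ∀ f ∈ A, f.IsHomogeneous d) {N : ℕ}
    (hN : ∀ j, X j ^ N ∈ Ideal.span A) {p : MvPolynomial (Fin n) k} {a D : ℕ} (ha : a ≤ n)
    (hD : D ≤ a * (d - 1))
    (h : ∃ c : Fin n →₀ ℕ, c.degree = D ∧ p * monomial c 1 ∉ Ideal.span A) :
    ∃ c : Fin n →₀ ℕ, c.degree = D ∧ p * monomial c 1 ∉ Ideal.span A ∧
      ∀ i ≤ a, initialDegree c i ≤ i * (d - 1) := by
  suffices key : ∀ b ≤ a, ∃ c : Fin n →₀ ℕ, c.degree = D ∧ p * monomial c 1 ∉ Ideal.span A ∧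
      ∀ i ≤ a, b ≤ i → initialDegree c i ≤ i * (d - 1) by
    obtain ⟨c, hc, hcp, hci⟩ := key 0 (Nat.zero_le a)
    exact ⟨c, hc, hcp, fun i hi => hci i hi (Nat.zero_le i)⟩
  intro b hb
  induction hb using Nat.decreasingInduction with
  | self =>
    obtain ⟨c, hc, hcp⟩ := h
    refine ⟨c, hc, hcp, fun i hi hi' => ?_⟩
    obtain rfl := le_antisymm hi hi'
    exact (initialDegree_le_degree c i).trans (hc.trans_le hD)
  | of_succ b hb ih =>
    obtain ⟨c, hc⟩ := ih
    induction hm : initialDegree c b using Nat.strong_induction_on generalizing c with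
    | _ m ihm =>
      obtain ⟨hcD, hcp, hci⟩ := hc
      by_cases hle : initialDegree c b ≤ b * (d - 1)
      · refine ⟨c, hcD, hcp, fun i hi hi' => ?_⟩
        rcases hi'.eq_or_lt with rfl | hlt
        · exact hle
        · exact hci i hi hlt
      set lo := c.filter fun j : Fin n => (j : ℕ) < b
      set hi := c.filter fun j : Fin n => ¬ (j : ℕ) < b
      have hsplit : lo + hi = c := Finsupp.filter_add_filter_not _ _
      have hlo0 : ∀ j : Fin n, b ≤ (j : ℕ) → lo j = 0 := fun j hj =>
        Finsupp.filter_apply_neg _ _ (by omega)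
      have hhi0 : ∀ j : Fin n, (j : ℕ) < b → hi j = 0 := fun j hj =>
        Finsupp.filter_apply_neg _ _ (by omega)
      have hlodeg : lo.degree = m := by
        rw [← initialDegree_eq_degree hlo0, ← hm, ← hsplit, initialDegree_add,
          initialDegree_eq_zero hhi0, add_zero]
      obtain ⟨z, hz, hzA, hzc⟩ := exists_sub_mem_of_degree_gt hd hA hN (hb.le.trans ha)
        (e := m) (by omega) (isHomogeneous_monomial (1 : k) hlodeg)
      have hpz : p * monomial hi 1 * z ∉ Ideal.span A := by
        intro hmem
        refine hcp ?_
        have hm : monomial (lo + hi) (1 : k) = monomial lo 1 * monomial hi 1 := by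
          rw [monomial_mul, one_mul]
        rw [← hsplit, hm]
        convert add_mem hmem ((Ideal.span A).mul_mem_left (p * monomial hi 1) hzA) using 1
        ring
      obtain ⟨x, hx, hxp⟩ := exists_mem_support_mul_monomial_notMem hpz
      have hxdeg : x.degree = m := by
        by_contra hne
        exact mem_support_iff.1 hx (hz.coeff_eq_zero hne)
      rw [mul_assoc, monomial_mul, mul_one] at hxp
      obtain ⟨j, hj, hxj⟩ := hzc x hx
      have hlt := initialDegree_lt_degree hj hxj
      refine ihm (initialDegree (hi + x) b) ?_ (hi + x) ⟨?_, hxp, fun i hia hbi => ?_⟩ rfl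
      · rw [initialDegree_add, initialDegree_eq_zero hhi0]
        omega
      · rw [← hcD, ← hsplit, map_add, map_add]
        omega
      · have hci' := hci i hia hbi
        have hloi : initialDegree lo i = lo.degree :=
          initialDegree_eq_degree fun j hj => hlo0 j (by omega)
        rw [← hsplit, initialDegree_add] at hci'
        rw [initialDegree_add]
        have := initialDegree_le_degree x i
        omega

/-- Outside a complete intersection of type `(d)^n`, every form of degree at most `n(d-1)` has a
monomial multiple of degree exactly `n(d-1)`. -/
lemma exists_monomial_mul_notMem [Infinite k] {n d : ℕ} (hd : 1 ≤ d)
    {f : ℕ → MvPolynomial (Fin n) k} (hf : ∀ i, (f i).IsHomogeneous d)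
    (hreg : RegularUpTo f n) {s : MvPolynomial (Fin n) k} {e D : ℕ} (he : e + D = n * (d - 1))
    (hse : s.IsHomogeneous e) (hs : s ∉ initialIdeal f n) :
    ∃ c : Fin n →₀ ℕ, c.degree = D ∧ s * monomial c 1 ∉ initialIdeal f n := by
  induction D generalizing s e with
  | zero => exact ⟨0, by simp, by simpa using hs⟩
  | succ D ih =>
    obtain ⟨j, hj⟩ : ∃ j, X j * s ∉ initialIdeal f n := by
      by_contra! hsoc
      rcases mem_initialIdeal_or_degree_eq hd hf hreg hse hsoc with h | h
      · exact hs h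
      · omega
    obtain ⟨c, hc, hcs⟩ := ih (by omega) ((isHomogeneous_X k j).mul hse) hj
    refine ⟨Finsupp.single j 1 + c, by simp [hc, add_comm], ?_⟩
    have hm : monomial (Finsupp.single j 1 + c) (1 : k) = X j * monomial c 1 := by
      rw [X, monomial_mul, one_mul]
    rwa [hm, mul_left_comm, ← mul_assoc]

end Monomials

section Weights

lemma sum_filter_val_lt_succ {n : ℕ} (F : Fin n → ℤ) {b : ℕ} (hb : b < n) :
    ∑ j with (j : Fin n).val < b + 1, F j = (∑ j with (j : Fin n).val < b, F j) + F ⟨b, hb⟩ := by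
  have : Finset.univ.filter (fun j : Fin n => j.val < b + 1) =
      insert ⟨b, hb⟩ (Finset.univ.filter fun j : Fin n => j.val < b) := by
    ext j
    simp [Fin.ext_iff]
    omega
  rw [this, Finset.sum_insert (by simp), add_comm]

/-- Abel summation: partial sums of `x` that are nonpositive give a lower bound for a weighted
partial sum with monotone weights. -/
lemma mul_sum_le_sum_mul_of_monotone {n : ℕ} {v x : Fin n → ℤ} (hv : Monotone v) {b : ℕ}
    (hb : b < n) (hx : ∀ i ≤ b, ∑ j with (j : Fin n).val < i, x j ≤ 0) :
    v ⟨b, hb⟩ * ∑ j with (j : Fin n).val < b + 1, x j ≤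
      ∑ j with (j : Fin n).val < b + 1, v j * x j := by
  induction b with
  | zero =>
    rw [sum_filter_val_lt_succ _ hb, sum_filter_val_lt_succ _ hb]
    simp
  | succ b ih =>
    have ih' := ih (by omega) fun i hi => hx i (by omega)
    rw [sum_filter_val_lt_succ _ hb, sum_filter_val_lt_succ (fun j => v j * x j) hb, mul_add]
    have hvb : v ⟨b, by omega⟩ ≤ v ⟨b + 1, hb⟩ := hv (by simp [Fin.le_def])
    have := mul_le_mul_of_nonpos_right hvb (hx (b + 1) le_rfl)
    omega

lemma weight_pos_of_initialDegree_le {n m : ℕ} {w : Fin n → ℤ} (hwsum : ∑ i, w i = 0)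
    (hwmono : Monotone w) {a : ℕ} (ha1 : 1 ≤ a) (ha2 : a < n)
    (hlt : ∀ i j : Fin n, (i : ℕ) < a → a ≤ (j : ℕ) → w i < w j)
    (heq : ∀ i j : Fin n, a ≤ (i : ℕ) → a ≤ (j : ℕ) → w i = w j)
    {c : Fin n →₀ ℕ} (hc : c.degree = n * m) (hci : ∀ i ≤ a, initialDegree c i ≤ i * m)
    (hca : initialDegree c a < a * m) : 0 < ∑ i, w i * (c i : ℤ) := by
  let W := w ⟨a, ha2⟩
  let x : Fin n → ℤ := fun j => c j - m
  have hpartial : ∀ i ≤ n, ∑ j with (j : Fin n).val < i, x j = initialDegree c i - i * m := by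
    intro i hi
    rw [Finset.sum_sub_distrib, Finset.sum_const, Fin.card_filter_val_lt, min_eq_right hi,
      initialDegree]
    simp
  have hxsum : ∑ j, x j = 0 := by
    rw [Finsupp.degree_eq_sum] at hc
    simp only [x, Finset.sum_sub_distrib, ← Nat.cast_sum, hc]
    simp
  have htotal : ∑ i, w i * (c i : ℤ) = ∑ i, (w i - W) * x i := by
    have h1 : ∀ i, (w i - W) * x i = w i * c i - w i * m - W * x i := fun i => by
      simp only [x]
      ring
    simp_rw [h1, Finset.sum_sub_distrib, ← Finset.mul_sum, ← Finset.sum_mul, hxsum, hwsum]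
    simp
  have hrestrict : ∑ i, (w i - W) * x i = ∑ j with (j : Fin n).val < a, (w j - W) * x j := by
    refine (Finset.sum_subset (Finset.filter_subset _ _) fun j _ hj => ?_).symm
    rw [heq j ⟨a, ha2⟩ (by simpa using hj) le_rfl, sub_self, zero_mul]
  obtain ⟨b, rfl⟩ : ∃ b, a = b + 1 := ⟨a - 1, by omega⟩
  have habel := mul_sum_le_sum_mul_of_monotone (v := fun j => w j - W) (x := x) (b := b)
    (fun i j hij => sub_le_sub_right (hwmono hij) W) (by omega) fun i hi => by
      rw [hpartial i (by omega), sub_nonpos]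
      exact_mod_cast hci i (by omega)
  rw [htotal, hrestrict]
  refine lt_of_lt_of_le (mul_pos_of_neg_of_neg ?_ ?_) habel
  · exact sub_neg.2 (hlt _ _ (by simp) le_rfl)
  · rw [hpartial _ ha2.le, sub_neg]
    exact_mod_cast hca

end Weights

/-- Under the hypotheses of Lemma 4.4 (balanced complete intersection `I` of type `(d)^n`,
weights `w_1 ≤ … ≤ w_n` not all zero summing to `0` with `w_a < w_{a+1} = … = w_n`, and
every monomial of degree `n(d-1)` of positive `w`-weight lying in `I`), every homogeneous
form of degree `(n-a)(d-1)+1` in the variables `x_{a+1},…,x_n` alone lies in `I`. -/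
theorem stmt5 {k : Type*} [Field k] [CharZero k] {n d : ℕ} (hd : 2 ≤ d)
    (g : Fin n → MvPolynomial (Fin n) k)
    (hhom : ∀ i, (g i).IsHomogeneous d)
    (hreg : RingTheory.Sequence.IsRegular (MvPolynomial (Fin n) k) (List.ofFn g))
    (w : Fin n → ℤ) (hw0 : w ≠ 0) (hwsum : ∑ i, w i = 0) (hwmono : Monotone w)
    (a : ℕ) (ha1 : 1 ≤ a) (ha2 : a ≤ n - 1)
    (hlt : ∀ i j : Fin n, (i : ℕ) < a → a ≤ (j : ℕ) → w i < w j)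
    (heq : ∀ i j : Fin n, a ≤ (i : ℕ) → a ≤ (j : ℕ) → w i = w j)
    (hlimit : ∀ c : Fin n →₀ ℕ, (∑ i, c i) = n * (d - 1) →
      0 < (∑ i, w i * (c i : ℤ)) → monomial c (1 : k) ∈ Ideal.span (Set.range g)) :
    ∀ p : MvPolynomial (Fin n) k,
      p ∈ MvPolynomial.supported k {i : Fin n | a ≤ (i : ℕ)} →
      p.IsHomogeneous ((n - a) * (d - 1) + 1) →
      p ∈ Ideal.span (Set.range g) := by
  intro p hpsupp hp
  by_contra hpI
  have hinf : Infinite k := CharZero.infinite k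
  have hd1 : 1 ≤ d := by omega
  let f : ℕ → MvPolynomial (Fin n) k := fun j => (List.ofFn g).getD j 0
  have hfreg : RegularUpTo f n := by
    have := regularUpTo_getD_of_isWeaklyRegular hreg.toIsWeaklyRegular
    rwa [List.length_ofFn] at this
  have hfhom : ∀ i, (f i).IsHomogeneous d := by
    intro i
    by_cases hi : i < (List.ofFn g).length
    · simpa only [f, List.getD_eq_getElem _ _ hi, List.getElem_ofFn] using hhom _
    · simpa only [f, List.getD_eq_default _ _ (not_lt.1 hi)] using isHomogeneous_zero _ _ _
  have hI : initialIdeal f n = Ideal.span (Set.range g) := by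
    have := initialIdeal_getD_eq_ofList_take (List.ofFn g) le_rfl
    rw [List.take_length, List.length_ofFn] at this
    rw [this, Ideal.ofList]
    congr 1
    ext x
    simp [List.mem_ofFn]
  have hA : ∀ q ∈ Set.range g, q.IsHomogeneous d := by
    rintro _ ⟨i, rfl⟩
    exact hhom i
  have hN : ∀ j : Fin n, X j ^ (n * (d - 1) + 1) ∈ Ideal.span (Set.range g) := fun j =>
    hI ▸ mem_initialIdeal_of_degree_gt hd1 hfhom hfreg (Nat.lt_succ_self _)
      (isHomogeneous_X_pow j _)
  have hdeg : (n - a) * (d - 1) + a * (d - 1) = n * (d - 1) := by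
    rw [← add_mul, Nat.sub_add_cancel (by omega)]
  have hpos : 1 ≤ a * (d - 1) := Nat.mul_pos ha1 (by omega)
  obtain ⟨c, hc, hcp, hci⟩ := exists_monomial_notMem_initialDegree_le hd1 hA hN
    (p := p) (a := a) (D := a * (d - 1) - 1) (by omega) (by omega) (by
      rw [← hI] at hpI ⊢
      exact exists_monomial_mul_notMem hd1 hfhom hfreg (by omega) hp hpI)
  rw [mul_comm] at hcp
  obtain ⟨y, hy, hyc⟩ := exists_mem_support_mul_monomial_notMem hcp
  have hydeg : y.degree = (n - a) * (d - 1) + 1 := by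
    by_contra hne
    exact mem_support_iff.1 hy (hp.coeff_eq_zero hne)
  have hy0 : ∀ j : Fin n, (j : ℕ) < a → y j = 0 := by
    intro j hj
    by_contra hne
    have := mem_supported.1 hpsupp
      (mem_vars_iff_mem_support j |>.2 ⟨y, hy, Finsupp.mem_support_iff.2 hne⟩)
    simp only [Set.mem_ofPred_eq] at this
    omega
  have hcy : ∀ i ≤ a, initialDegree (c + y) i = initialDegree c i := fun i hi => by
    rw [initialDegree_add, initialDegree_eq_zero (c := y) fun j hj => hy0 j (by omega), add_zero]
  have hcydeg : (c + y).degree = n * (d - 1) := by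
    rw [map_add, hc, hydeg]
    omega
  rw [monomial_mul, mul_one] at hyc
  refine hyc (hlimit (c + y) (by rw [← Finsupp.degree_eq_sum, hcydeg]) ?_)
  refine weight_pos_of_initialDegree_le hwsum hwmono ha1 (by omega) hlt heq hcydeg ?_ ?_
  · intro i hi
    rw [hcy i hi]
    exact hci i hi
  · rw [hcy a le_rfl]
    have := initialDegree_le_degree c a
    omega
end
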